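/- arXiv:math/0605140 — 9 statements merged into one kernel-verified Lean document; each statement's English description precedes it below -/
import Mathlib

section
/- Let R be a commutative ring, π ∈ R a non-zero-divisor, R̂ its π-adic completion, and α : R[1/π] → R̂[1/π] the ring homomorphism induced on localizations by the canonical map R → R̂. Then an element x ∈ R[1/π] is integral over R if and only if α(x) is integral over R̂; in other words, the integral closure of R in R[1/π] is the preimage under α of the integral closure of R̂ in R̂[1/π]. -/
open Polynomial in
/-- Integrality in `R[1/π]` descends along any ring map `φ : R → S` such that every quotient map
`R → R / (π ^ N)` factors through `φ`. -/
theorem isIntegral_of_isIntegral_awayMap {R S : Type*} [CommRing R] [CommRing S] (φ : R →+* S)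
    {π : R} (hπ : π ∈ nonZeroDivisors R)
    (hφ : ∀ N : ℕ, ∃ e : S →+* R ⧸ Ideal.span {π ^ N}, e.comp φ = Ideal.Quotient.mk _)
    {x : Localization.Away π} (hx : IsIntegral S (Localization.awayMap φ π x)) :
    IsIntegral R x := by
  obtain ⟨n, a, hxa⟩ := IsLocalization.Away.surj π x
  rw [← map_pow] at hxa
  by_cases hu : IsUnit π
  · obtain ⟨u, hu⟩ := (hu.pow n).exists_right_inv
    have : x = algebraMap R _ (a * u) := by
      rw [map_mul, ← hxa, mul_assoc, ← map_mul, hu, map_one, mul_one]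
    exact this ▸ isIntegral_algebraMap
  obtain ⟨p₀, hp₀, hp₀x⟩ := hx
  obtain ⟨p, hp, hpx, hpd⟩ : ∃ p : S[X], p.Monic ∧
      p.eval₂ (algebraMap S (Localization.Away (φ π))) (Localization.awayMap φ π x) = 0 ∧
      (Nontrivial S → p.natDegree ≠ 0) :=
    ⟨X * p₀, monic_X.mul hp₀, by rw [eval₂_mul, hp₀x, mul_zero], fun _ ↦ by
      rw [monic_X.natDegree_mul hp₀]; simp⟩
  have hmap (r : R) : Localization.awayMap φ π (algebraMap R _ r) = algebraMap S _ (φ r) :=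
    IsLocalization.map_eq _ r
  have hroot := scaleRoots_eval₂_eq_zero (s := φ (π ^ n)) _ hpx
  rw [← hmap, ← map_mul, mul_comm, hxa, hmap, eval₂_at_apply] at hroot
  obtain ⟨⟨_, m, rfl⟩, hm⟩ :=
    (IsLocalization.map_eq_zero_iff (Submonoid.powers (φ π)) _ _).mp hroot
  obtain ⟨e, he⟩ := hφ (m + n * p.natDegree + 1)
  have he' (r : R) : e (φ r) = Ideal.Quotient.mk _ r := RingHom.congr_fun he r
  have : Nontrivial (R ⧸ Ideal.span {π ^ (m + n * p.natDegree + 1)}) := by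
    rw [Ideal.Quotient.nontrivial_iff, Ne, Ideal.span_singleton_eq_top]
    exact fun h ↦ hu ((isUnit_pow_iff (Nat.succ_ne_zero _)).mp h)
  have : Nontrivial S := e.domain_nontrivial
  obtain ⟨q, hqp, hqd, hq⟩ := lifts_and_natDegree_eq_and_monic
    (f := Ideal.Quotient.mk (Ideal.span {π ^ (m + n * p.natDegree + 1)})) (p := p.map e)
    ((lifts_iff_coeff_lifts _).mpr fun _ ↦ Ideal.Quotient.mk_surjective _) (hp.map e)
  rw [hp.natDegree_map e] at hqd
  have hscale : (p.scaleRoots (φ (π ^ n))).map e = (q.scaleRoots (π ^ n)).map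
      (Ideal.Quotient.mk (Ideal.span {π ^ (m + n * p.natDegree + 1)})) := by
    rw [map_scaleRoots _ _ _ (by simp [hp]), map_scaleRoots _ _ _ (by simp [hq]), hqp, he']
  have hdvd : π ^ (m + n * p.natDegree + 1) ∣ π ^ m * (q.scaleRoots (π ^ n)).eval a := by
    rw [← Ideal.mem_span_singleton, ← Ideal.Quotient.eq_zero_iff_mem, map_mul, ← eval_map_apply,
      ← hscale, ← he' a, eval_map_apply, ← he', ← map_mul, map_pow, hm, map_zero]
  obtain ⟨r, hr⟩ := hdvd
  have hqa : (q.scaleRoots (π ^ n)).eval a = (π ^ n) ^ p.natDegree * (π * r) := by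
    refine (mul_cancel_left_mem_nonZeroDivisors (pow_mem hπ m)).mp (hr.trans ?_)
    ring
  have hqx : aeval x q = algebraMap R _ (π * r) := by
    have h := scaleRoots_eval₂_mul (p := q) (algebraMap R (Localization.Away π)) x (π ^ n)
    rw [mul_comm _ x, hxa, eval₂_at_apply, hqa, hqd, map_mul, map_pow] at h
    exact ((IsLocalization.map_units _
      (⟨π ^ n, n, rfl⟩ : Submonoid.powers π)).pow _).mul_left_cancel h.symm
  refine IsIntegral.of_aeval_monic hq (hqd ▸ hpd ‹_›) ?_
  rw [hqx]
  exact isIntegral_algebraMap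

/-- For `π` a non-zero-divisor of `R`, `R̂` the `π`-adic completion and
`α : R[1/π] → R̂[1/π]` the induced map on localizations, an element `x ∈ R[1/π]` is
integral over `R` iff `α x` is integral over `R̂`. -/
theorem stmt1 {R : Type*} [CommRing R] (π : R) (hπ : π ∈ nonZeroDivisors R)
    (x : Localization.Away π) :
    IsIntegral R x ↔
      IsIntegral (AdicCompletion (Ideal.span {π}) R)
        (Localization.awayMap (algebraMap R (AdicCompletion (Ideal.span {π}) R)) π x) := by
  refine ⟨fun h ↦ ?_, isIntegral_of_isIntegral_awayMap _ hπ fun N ↦ ?_⟩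
  · refine h.map_of_comp_eq (algebraMap R (AdicCompletion (Ideal.span {π}) R))
      (Localization.awayMap (algebraMap R (AdicCompletion (Ideal.span {π}) R)) π) ?_
    exact (IsLocalization.map_comp _).symm
  · rw [← Ideal.span_singleton_pow]
    exact ⟨AdicCompletion.evalₐ (Ideal.span {π}) N, (AdicCompletion.evalₐ _ N).comp_algebraMap⟩
end

section
/- Let R be a commutative ring and π ∈ R a non-zero-divisor. If R is integrally closed in R[1/π], then the π-adic completion R̂ is integrally closed in R̂[1/π] (where R̂[1/π] is the localization of R̂ at the powers of the image of π). -/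
/-- The kernel of reduction modulo `π ^ n` on the `π`-adic completion is generated by `π ^ n`. -/
theorem AdicCompletion.algebraMap_pow_dvd_of_evalₐ_eq_zero {R : Type*} [CommRing R] (π : R)
    (n : ℕ) {s : AdicCompletion (Ideal.span {π}) R}
    (hs : AdicCompletion.evalₐ (Ideal.span {π}) n s = 0) :
    algebraMap R (AdicCompletion (Ideal.span {π}) R) π ^ n ∣ s := by
  have hker : s ∈ (AdicCompletion.eval (Ideal.span {π}) R n).ker := by
    have hle : Ideal.span {π} ^ n ≤ (Ideal.span {π} ^ n • ⊤ : Ideal R) := by simp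
    rw [LinearMap.mem_ker, ← AdicCompletion.factor_evalₐ_eq_eval _ s hle, hs, _root_.map_zero]
  rw [← AdicCompletion.pow_smul_top_eq_ker_eval (Submodule.fg_span_singleton π),
    Ideal.span_singleton_pow, Submodule.ideal_span_singleton_smul,
    Submodule.mem_smul_pointwise_iff_exists] at hker
  obtain ⟨t, -, rfl⟩ := hker
  exact ⟨t, by rw [Algebra.smul_def, map_pow]⟩

open Polynomial in
/-- Let `p` be a monic polynomial of positive degree and `b / π ^ k ∈ R[1/π]` with
`p (b / π ^ k) ∈ R`. If `R` is integrally closed in `R[1/π]`, then `π ^ k` divides `b`. -/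
theorem pow_dvd_of_eval_scaleRoots_eq {R A : Type*} [CommRing R] [CommRing A] [Algebra R A]
    {π : R} [IsLocalization.Away π A] (hπ : π ∈ nonZeroDivisors R)
    (h : ∀ x : A, IsIntegral R x → x ∈ (algebraMap R A).range)
    {p : R[X]} (hp : p.Monic) (hdeg : 0 < p.natDegree) {k : ℕ} {b c : R}
    (hb : (p.scaleRoots (π ^ k)).eval b = (π ^ k) ^ p.natDegree * c) : π ^ k ∣ b := by
  have hu : IsUnit (algebraMap R A (π ^ k)) := by
    rw [map_pow]; exact (IsLocalization.Away.algebraMap_isUnit π).pow k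
  obtain ⟨β, hβ⟩ : ∃ β, algebraMap R A (π ^ k) * β = algebraMap R A b := hu.dvd.imp fun _ ↦ Eq.symm
  have hroot : p.eval₂ (algebraMap R A) β = algebraMap R A c := by
    refine (hu.pow p.natDegree).mul_left_cancel ?_
    rw [← scaleRoots_eval₂_mul, hβ, eval₂_at_apply, hb, map_mul, map_pow]
  have hint : IsIntegral R β :=
    ⟨p - C c, hp.sub_of_left (degree_C_le.trans_lt (natDegree_pos_iff_degree_pos.mp hdeg)), by
      rw [eval₂_sub, hroot, eval₂_C, sub_self]⟩
  obtain ⟨r, rfl⟩ := h β hint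
  have hinj : Function.Injective (algebraMap R A) :=
    IsLocalization.injective A (Submonoid.powers_le.mpr hπ)
  exact ⟨r, (hinj (by rw [← hβ, map_mul])).symm⟩

open Polynomial in
/-- Let `S` be an `R`-algebra which agrees with `R` modulo every power of a non-zero-divisor `π`.
If `R` is integrally closed in `R[1/π]`, then `S` is integrally closed in `S[1/π]`. -/
theorem mem_range_algebraMap_of_isIntegral_away {R S A B : Type*} [CommRing R] [CommRing S]
    [CommRing A] [CommRing B] [Algebra R S] [Algebra R A] [Algebra S B] {π : R}
    [IsLocalization.Away π A] [IsLocalization.Away (algebraMap R S π) B]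
    (hπ : π ∈ nonZeroDivisors R)
    (h : ∀ x : A, IsIntegral R x → x ∈ (algebraMap R A).range)
    (φ : ∀ n, S →ₐ[R] R ⧸ Ideal.span {π} ^ n)
    (hφ : ∀ n s, φ n s = 0 → algebraMap R S π ^ n ∣ s)
    (y : B) (hy : IsIntegral S y) : y ∈ (algebraMap S B).range := by
  obtain ⟨a, ⟨_, k, rfl⟩, hya⟩ :=
    IsLocalization.exists_mk'_eq (Submonoid.powers (algebraMap R S π)) y
  replace hya : algebraMap S B (algebraMap R S π ^ k) * y = algebraMap S B a := by
    rw [← hya]; exact IsLocalization.mk'_spec' B a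
      (⟨algebraMap R S π ^ k, k, rfl⟩ : Submonoid.powers (algebraMap R S π))
  have hu : IsUnit (algebraMap S B (algebraMap R S π ^ k)) := by
    rw [map_pow]; exact (IsLocalization.Away.algebraMap_isUnit (algebraMap R S π)).pow k
  suffices hdvd : algebraMap R S π ^ k ∣ a by
    obtain ⟨s, rfl⟩ := hdvd
    exact ⟨s, hu.mul_left_cancel (by rw [hya, map_mul])⟩
  rcases subsingleton_or_nontrivial S with hS | hS
  · exact ⟨0, Subsingleton.elim _ _⟩
  obtain ⟨p, hp, hdeg, hpy⟩ : ∃ p : S[X], p.Monic ∧ 0 < p.natDegree ∧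
      p.eval₂ (algebraMap S B) y = 0 := by
    obtain ⟨p, hp, hpy⟩ := hy
    exact ⟨p * X, hp.mul monic_X, by rw [natDegree_mul_X hp.ne_zero]; lia,
      by rw [eval₂_mul, hpy, zero_mul]⟩
  obtain ⟨m, hm⟩ : ∃ m : ℕ,
      algebraMap R S π ^ m * (p.scaleRoots (algebraMap R S π ^ k)).eval a = 0 := by
    have hzero : algebraMap S B ((p.scaleRoots (algebraMap R S π ^ k)).eval a) =
        algebraMap S B 0 := by
      rw [← eval₂_at_apply, ← hya, scaleRoots_eval₂_mul, hpy, mul_zero, map_zero]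
    obtain ⟨m, hm⟩ := IsLocalization.Away.exists_of_eq (algebraMap R S π) hzero
    exact ⟨m, by rw [hm, mul_zero]⟩
  set n := p.natDegree with hn
  set N := m + k * n + k with hN
  have hkN : algebraMap R S π ^ k ∣ algebraMap R S π ^ N := pow_dvd_pow _ (by lia)
  rcases subsingleton_or_nontrivial (R ⧸ Ideal.span {π} ^ N) with hQ | hQ
  · exact hkN.trans (hφ N a (Subsingleton.elim _ _))
  have hφalg (r : R) : φ N (algebraMap R S r) = Ideal.Quotient.mk _ r := (φ N).commutes r
  obtain ⟨b, hb⟩ := Ideal.Quotient.mk_surjective (φ N a)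
  obtain ⟨q, hqp, hqn, hq⟩ := lifts_and_natDegree_eq_and_monic
    (f := Ideal.Quotient.mk (Ideal.span {π} ^ N)) (p := p.map (φ N : S →+* _))
    (map_surjective _ Ideal.Quotient.mk_surjective _) (hp.map _)
  rw [hp.natDegree_map, ← hn] at hqn
  have hmk : Ideal.Quotient.mk (Ideal.span {π} ^ N)
      (π ^ m * (q.scaleRoots (π ^ k)).eval b) = 0 := by
    have hm' := congrArg (φ N : S →+* R ⧸ Ideal.span {π} ^ N) hm
    rw [map_mul, map_zero, ← eval_map_apply, map_scaleRoots _ _ _ (by simp [hp.leadingCoeff]),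
      ← hqp] at hm'
    rw [map_mul, ← eval_map_apply, map_scaleRoots _ _ _ (by simp [hq.leadingCoeff]), hb]
    simpa [hφalg] using hm'
  rw [Ideal.Quotient.eq_zero_iff_mem, Ideal.span_singleton_pow,
    Ideal.mem_span_singleton] at hmk
  obtain ⟨e, he⟩ := hmk
  have hdvd : π ^ k ∣ b := by
    refine pow_dvd_of_eval_scaleRoots_eq hπ h hq (hqn ▸ hdeg) (c := π ^ k * e) ?_
    refine (mul_cancel_left_mem_nonZeroDivisors (pow_mem hπ m)).mp ?_
    rw [he, hqn, hN]; ring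
  obtain ⟨r, rfl⟩ := hdvd
  have hsub : φ N (a - algebraMap R S (π ^ k * r)) = 0 := by
    rw [map_sub, hφalg, hb, sub_self]
  refine (dvd_sub_left (c := algebraMap R S (π ^ k * r)) ?_).mp (hkN.trans (hφ N _ hsub))
  exact ⟨algebraMap R S r, by rw [map_mul, map_pow]⟩

/-- If `π` is a non-zero-divisor of `R` and `R` is integrally closed in
`R[1/π]`, then the `π`-adic completion `R̂` is integrally closed in `R̂[1/π]`. -/
theorem stmt2 {R : Type*} [CommRing R] (π : R) (hπ : π ∈ nonZeroDivisors R)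
    (h : ∀ x : Localization.Away π, IsIntegral R x →
      x ∈ (algebraMap R (Localization.Away π)).range) :
    ∀ y : Localization.Away (algebraMap R (AdicCompletion (Ideal.span {π}) R) π),
      IsIntegral (AdicCompletion (Ideal.span {π}) R) y →
        y ∈ (algebraMap (AdicCompletion (Ideal.span {π}) R)
          (Localization.Away (algebraMap R (AdicCompletion (Ideal.span {π}) R) π))).range := by
  exact mem_range_algebraMap_of_isIntegral_away hπ h (AdicCompletion.evalₐ (Ideal.span {π}))
    fun n _ ↦ AdicCompletion.algebraMap_pow_dvd_of_evalₐ_eq_zero π n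
end

section
/- Let R be a commutative ring and π ∈ R a non-zero-divisor. Denote by R̄ the integral closure of R in R[1/π], by R̂ the π-adic completion of R, and by S̄ the integral closure of R̂ in R̂[1/π]. Then there is a canonical isomorphism of R-algebras between the π-adic completion of R̄ and the π-adic completion of S̄ (completions taken with respect to the ideal generated by the image of π), compatible with the natural maps from R. -/
/-- The integral closure of `A` in `A[1/σ]`. -/
noncomputable abbrev intClAway (A : Type*) [CommRing A] (σ : A) :
    Subalgebra A (Localization.Away σ) :=
  integralClosure A (Localization.Away σ)

/-- The `σ`-adic completion of the integral closure of `A` in `A[1/σ]` (completion with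
respect to the ideal generated by the image of `σ`). -/
noncomputable abbrev intClAwayCompl (A : Type*) [CommRing A] (σ : A) : Type _ :=
  AdicCompletion (Ideal.span {algebraMap A (intClAway A σ) σ}) (intClAway A σ)

/-- The natural map from `A` to the completion of the integral closure of `A` in `A[1/σ]`. -/
noncomputable abbrev fromBase (A : Type*) [CommRing A] (σ : A) : A →+* intClAwayCompl A σ :=
  (algebraMap (intClAway A σ) (intClAwayCompl A σ)).comp (algebraMap A (intClAway A σ))

theorem AdicCompletion.factorPow_evalₐ {R : Type*} [CommRing R] (I : Ideal R) {m n : ℕ}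
    (h : m ≤ n) (x : AdicCompletion I R) :
    Ideal.Quotient.factorPow I h (evalₐ I n x) = evalₐ I m x := by
  induction x using AdicCompletion.induction_on with
  | _ x => simp [AdicCompletion.Ideal.mk_eq_mk I h]

/-- A ring homomorphism inducing isomorphisms modulo all powers of `b` induces an isomorphism
between the `b`-adic completions. -/
theorem exists_adicCompletion_ringEquiv {B C : Type*} [CommRing B] [CommRing C] (g : B →+* C)
    (b : B) (c : C) (hc : g b = c) (hinj : ∀ n x, c ^ n ∣ g x → b ^ n ∣ x)
    (hsurj : ∀ n y, ∃ x, c ^ n ∣ y - g x) :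
    ∃ e : AdicCompletion (Ideal.span {b}) B ≃+* AdicCompletion (Ideal.span {c}) C,
      ∀ x, e (algebraMap B _ x) = algebraMap C _ (g x) := by
  set I := Ideal.span {b}
  set J := Ideal.span {c}
  have hle (n : ℕ) : I ^ n ≤ (J ^ n).comap g := by
    simp [I, J, Ideal.span_singleton_pow, hc]
  let q (n : ℕ) : B ⧸ I ^ n →+* C ⧸ J ^ n := Ideal.quotientMap (J ^ n) g (hle n)
  have hq (n : ℕ) : Function.Bijective (q n) := by
    constructor
    · refine Ideal.quotientMap_injective' fun x hx ↦ ?_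
      rw [Ideal.mem_comap, Ideal.span_singleton_pow, Ideal.mem_span_singleton] at hx
      rw [Ideal.span_singleton_pow, Ideal.mem_span_singleton]
      exact hinj n x hx
    · intro y
      obtain ⟨y, rfl⟩ := Ideal.Quotient.mk_surjective y
      obtain ⟨x, hx⟩ := hsurj n y
      refine ⟨Ideal.Quotient.mk _ x, ?_⟩
      rw [Ideal.quotientMap_mk, eq_comm, Ideal.Quotient.mk_eq_mk_iff_sub_mem,
        Ideal.span_singleton_pow, Ideal.mem_span_singleton]
      exact hx
  let Q (n : ℕ) : B ⧸ I ^ n ≃+* C ⧸ J ^ n := RingEquiv.ofBijective (q n) (hq n)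
  have hQ {m n : ℕ} (h : m ≤ n) (x : B ⧸ I ^ n) :
      Ideal.Quotient.factorPow J h (Q n x) = Q m (Ideal.Quotient.factorPow I h x) := by
    obtain ⟨x, rfl⟩ := Ideal.Quotient.mk_surjective x
    rfl
  have hQ' {m n : ℕ} (h : m ≤ n) (y : C ⧸ J ^ n) :
      Ideal.Quotient.factorPow I h ((Q n).symm y) =
        (Q m).symm (Ideal.Quotient.factorPow J h y) := by
    rw [RingEquiv.eq_symm_apply, ← hQ, RingEquiv.apply_symm_apply]
  let F : AdicCompletion I B →+* AdicCompletion J C :=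
    AdicCompletion.liftRingHom J
      (fun n ↦ (Q n).toRingHom.comp (AdicCompletion.evalₐ I n).toRingHom)
      (fun h ↦ by ext x; exact (hQ h _).trans (congrArg _ (AdicCompletion.factorPow_evalₐ I h x)))
  let G : AdicCompletion J C →+* AdicCompletion I B :=
    AdicCompletion.liftRingHom I
      (fun n ↦ (Q n).symm.toRingHom.comp (AdicCompletion.evalₐ J n).toRingHom)
      (fun h ↦ by ext x; exact (hQ' h _).trans (congrArg _ (AdicCompletion.factorPow_evalₐ J h x)))
  have hF (n x) : AdicCompletion.evalₐ J n (F x) = Q n (AdicCompletion.evalₐ I n x) := by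
    exact AdicCompletion.evalₐ_liftRingHom _ _ _ _ _
  have hG (n x) : AdicCompletion.evalₐ I n (G x) = (Q n).symm (AdicCompletion.evalₐ J n x) := by
    exact AdicCompletion.evalₐ_liftRingHom _ _ _ _ _
  refine ⟨RingEquiv.ofRingHom F G ?_ ?_, fun x ↦ ?_⟩
  · ext1 x
    exact AdicCompletion.ext_evalₐ fun n ↦ by simp [hF, hG]
  · ext1 x
    exact AdicCompletion.ext_evalₐ fun n ↦ by simp [hF, hG]
  · refine AdicCompletion.ext_evalₐ fun n ↦ ?_
    rw [RingEquiv.ofRingHom_apply, hF, AdicCompletion.algebraMap_apply,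
      AdicCompletion.algebraMap_apply, AdicCompletion.evalₐ_of, AdicCompletion.evalₐ_of]
    rfl

section Completion

variable {R : Type*} [CommRing R] (π : R)

theorem pow_dvd_of_pow_dvd_algebraMap_adicCompletion (n : ℕ) (r : R)
    (h : algebraMap R (AdicCompletion (Ideal.span {π}) R) π ^ n ∣ algebraMap R _ r) :
    π ^ n ∣ r := by
  have := map_dvd (AdicCompletion.evalₐ (Ideal.span {π}) n) h
  rw [← map_pow, AlgHom.commutes, AlgHom.commutes, Ideal.Quotient.algebraMap_eq,
    Ideal.Quotient.eq_zero_iff_mem.2 (by simp [Ideal.span_singleton_pow]),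
    zero_dvd_iff, Ideal.Quotient.eq_zero_iff_mem, Ideal.span_singleton_pow,
    Ideal.mem_span_singleton] at this
  exact this

theorem exists_pow_dvd_sub_algebraMap_adicCompletion (n : ℕ)
    (a : AdicCompletion (Ideal.span {π}) R) :
    ∃ r, algebraMap R (AdicCompletion (Ideal.span {π}) R) π ^ n ∣ a - algebraMap R _ r := by
  obtain ⟨r, hr⟩ := Submodule.mkQ_surjective _ (AdicCompletion.eval (Ideal.span {π}) R n a)
  refine ⟨r, ?_⟩
  have hmem : a - algebraMap R _ r ∈ (AdicCompletion.eval (Ideal.span {π}) R n).ker := by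
    rw [LinearMap.mem_ker, map_sub, ← hr, AdicCompletion.algebraMap_apply]
    exact sub_self _
  rw [← AdicCompletion.pow_smul_top_eq_ker_eval ⟨{π}, by simp⟩, Ideal.span_singleton_pow,
    Submodule.ideal_span_singleton_smul, Submodule.mem_smul_pointwise_iff_exists] at hmem
  obtain ⟨y, -, hy⟩ := hmem
  exact ⟨y, by rw [← hy, Algebra.smul_def, map_pow]⟩

theorem algebraMap_adicCompletion_mem_nonZeroDivisors (hπ : π ∈ nonZeroDivisors R) :
    algebraMap R (AdicCompletion (Ideal.span {π}) R) π ∈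
      nonZeroDivisors (AdicCompletion (Ideal.span {π}) R) := by
  rw [mem_nonZeroDivisors_iff_right]
  intro a ha
  refine AdicCompletion.ext_evalₐ fun n ↦ ?_
  obtain ⟨r, b, hb⟩ := exists_pow_dvd_sub_algebraMap_adicCompletion π (n + 1) a
  have hr : π ^ (n + 1) ∣ r * π := by
    refine pow_dvd_of_pow_dvd_algebraMap_adicCompletion π _ _ ⟨-(b * algebraMap R _ π), ?_⟩
    rw [map_mul]
    linear_combination ha - algebraMap R _ π * hb
  obtain ⟨s, hs⟩ := hr
  have hs' : r = π ^ n * s := (mul_cancel_right_mem_nonZeroDivisors hπ).1 (by rw [hs]; ring)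
  have ha' : a = algebraMap R _ (π ^ n) * (algebraMap R _ s + algebraMap R _ π * b) := by
    rw [sub_eq_iff_eq_add.1 hb, hs']
    simp only [map_mul, map_pow]
    ring
  rw [ha', map_mul, AlgHom.commutes, Ideal.Quotient.algebraMap_eq,
    Ideal.Quotient.eq_zero_iff_mem.2 (by simp [Ideal.span_singleton_pow]),
    zero_mul, map_zero]

end Completion

section Descent

open Polynomial

variable {R A K L : Type*} [CommRing R] [CommRing A] [CommRing K] [CommRing L]
  [Algebra R K] [Algebra A L] (f : R →+* A) (φ : K →+* L)

theorem exists_algebraMap_mul_pow_eq (π : R) [IsLocalization.Away π K] (z : K) (d : ℕ) :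
    ∃ N, ∀ i < d, ∃ r, algebraMap R K (π ^ N) * z ^ i = algebraMap R K r := by
  obtain ⟨k, r, hr⟩ := IsLocalization.Away.surj π z
  refine ⟨k * d, fun i hi ↦ ⟨π ^ (k * (d - i)) * r ^ i, ?_⟩⟩
  obtain ⟨j, rfl⟩ := Nat.exists_eq_add_of_le hi.le
  rw [Nat.add_sub_cancel_left, map_mul, map_pow, map_pow, map_pow, ← hr]
  ring

/-- Integrality over `A` descends to integrality over `R` along `R[1/π] → A[1/π]` as soon as
`R → A` induces isomorphisms modulo all powers of `π`. -/
theorem isIntegral_of_isIntegral_map (π : R) [IsLocalization.Away π K]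
    (hφ : φ.comp (algebraMap R K) = (algebraMap A L).comp f)
    (hL : Function.Injective (algebraMap A L))
    (hinj : ∀ n x, f π ^ n ∣ f x → π ^ n ∣ x) (hsurj : ∀ n y, ∃ x, f π ^ n ∣ y - f x)
    (z : K) (hz : IsIntegral A (φ z)) : IsIntegral R z := by
  replace hφ (r : R) : φ (algebraMap R K r) = algebraMap A L (f r) := RingHom.congr_fun hφ r
  nontriviality K
  have : Nontrivial R := (algebraMap R K).domain_nontrivial
  obtain ⟨p, hp, hpz⟩ := hz
  let d := p.natDegree + 1
  let c (i : ℕ) : A := (p * X).coeff i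
  have hc : φ z ^ d + ∑ i ∈ Finset.range d, algebraMap A L (c i) * φ z ^ i = 0 := by
    rw [hp.as_sum] at hpz
    simp only [eval₂_add, eval₂_X_pow, eval₂_finsetSum, eval₂_mul, eval₂_C] at hpz
    simp only [c, d, Finset.sum_range_succ', coeff_mul_X, mul_coeff_zero, coeff_X_zero, mul_zero,
      map_zero, zero_mul, add_zero, pow_succ, ← mul_assoc, ← Finset.sum_mul]
    rw [← add_mul, hpz, zero_mul]
  obtain ⟨N, hN⟩ := exists_algebraMap_mul_pow_eq π z d
  choose! r hr using hN
  choose g b hb using fun i ↦ hsurj N (c i)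
  let s : R[X] := ∑ i ∈ Finset.range d, C (g i) * X ^ i
  have hs : s.degree < d := by
    refine (degree_sum_le _ _).trans_lt ((Finset.sup_lt_iff (WithBot.bot_lt_coe d)).2 ?_)
    intro i hi
    exact (degree_C_mul_X_pow_le _ _).trans_lt (Nat.cast_lt.2 (Finset.mem_range.1 hi))
  have hq : (X ^ d + s).Monic := monic_X_pow_add hs
  have hqd : (X ^ d + s).natDegree ≠ 0 := by
    rw [natDegree_eq_of_degree_eq_some (n := d)]
    · simp [d]
    · rw [degree_add_eq_left_of_degree_lt] <;> simp [hs]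
  refine IsIntegral.of_aeval_monic hq hqd ?_
  set w := aeval z (X ^ d + s) with hw
  have hφw : φ w = algebraMap A L (-∑ i ∈ Finset.range d, b i * f (r i)) := by
    have h : φ w = φ z ^ d + ∑ i ∈ Finset.range d, algebraMap A L (f (g i)) * φ z ^ i := by
      simp [hw, s, hφ]
    rw [h, map_neg, eq_neg_iff_add_eq_zero, map_sum, add_assoc, ← Finset.sum_add_distrib, ← hc]
    congr 1
    refine Finset.sum_congr rfl fun i hi ↦ ?_
    have h₁ := congrArg φ (hr i (Finset.mem_range.1 hi))
    have h₂ := congrArg (algebraMap A L) (hb i)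
    simp only [map_mul, map_pow, map_sub, hφ] at h₁ h₂ ⊢
    linear_combination -algebraMap A L (b i) * h₁ - φ z ^ i * h₂
  obtain ⟨k, r', hr'⟩ := IsLocalization.Away.surj π w
  obtain ⟨t, rfl⟩ : π ^ k ∣ r' := by
    refine hinj k r' ⟨-∑ i ∈ Finset.range d, b i * f (r i), hL ?_⟩
    rw [← hφ, ← hr', map_mul, hφw, map_pow, hφ, map_mul, map_pow, mul_comm]
  rw [map_mul, map_pow, mul_comm] at hr'
  rw [((IsLocalization.Away.algebraMap_isUnit (S := K) π).pow k).mul_left_cancel hr']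
  exact isIntegral_algebraMap

end Descent

/-- If `R → A` induces isomorphisms modulo all powers of the non-zero-divisor `π`, whose image in
`A` is a non-zero-divisor, then the integral closures of `R` in `R[1/π]` and of `A` in `A[1/π]`
have the same `π`-adic completion. -/
theorem exists_intClAwayCompl_ringEquiv {R A : Type*} [CommRing R] [CommRing A] (f : R →+* A)
    (π : R) (hA : f π ∈ nonZeroDivisors A)
    (hinj : ∀ n x, f π ^ n ∣ f x → π ^ n ∣ x) (hsurj : ∀ n y, ∃ x, f π ^ n ∣ y - f x) :
    ∃ e : intClAwayCompl R π ≃+* intClAwayCompl A (f π),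
      ∀ r, e (fromBase R π r) = fromBase A (f π) (f r) := by
  let φ : Localization.Away π →+* Localization.Away (f π) := Localization.awayMap f π
  have hφ : φ.comp (algebraMap R _) = (algebraMap A _).comp f :=
    IsLocalization.map_comp _
  have hφ' (r : R) : φ (algebraMap R _ r) = algebraMap A _ (f r) := RingHom.congr_fun hφ r
  have hL : Function.Injective (algebraMap A (Localization.Away (f π))) :=
    IsLocalization.injective _ (Submonoid.powers_le.2 hA)
  have hint (z) (hz : IsIntegral A (φ z)) : IsIntegral R z :=
    isIntegral_of_isIntegral_map f φ π hφ hL hinj hsurj z hz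
  have hint' (z) (hz : IsIntegral R z) : IsIntegral A (φ z) := hz.map_of_comp_eq f φ hφ.symm
  let g : intClAway R π →+* intClAway A (f π) :=
    (φ.comp (intClAway R π).val.toRingHom).codRestrict (intClAway A (f π)).toSubring
      fun z ↦ hint' z z.2
  have hg (z : intClAway R π) : (g z : Localization.Away (f π)) = φ z := rfl
  have hgf (r : R) : g (algebraMap R _ r) = algebraMap A _ (f r) := Subtype.ext (hφ' r)
  have hg_inj (n x) (h : algebraMap A (intClAway A (f π)) (f π) ^ n ∣ g x) :
      algebraMap R (intClAway R π) π ^ n ∣ x := by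
    obtain ⟨y, hy⟩ := h
    have hu := (IsLocalization.Away.algebraMap_isUnit (S := Localization.Away π) π).pow n
    obtain ⟨z, hz⟩ := hu.dvd (a := (x : Localization.Away π))
    have hzy : φ z = y := by
      have hu' := (IsLocalization.Away.algebraMap_isUnit (S := Localization.Away (f π)) (f π)).pow n
      refine hu'.mul_left_cancel ?_
      rw [← hφ', ← map_pow, ← map_mul, ← hz, ← hg, hy, map_pow, hφ']
      rfl
    exact ⟨⟨z, hint z (hzy ▸ y.2)⟩, Subtype.ext hz⟩
  have hg_surj (n y) : ∃ x, algebraMap A (intClAway A (f π)) (f π) ^ n ∣ y - g x := by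
    obtain ⟨m, a, ha⟩ := IsLocalization.Away.surj (f π) (y : Localization.Away (f π))
    obtain ⟨r, b, hb⟩ := hsurj (m + n) a
    have hu := (IsLocalization.Away.algebraMap_isUnit (S := Localization.Away π) π).pow m
    have hu' := (IsLocalization.Away.algebraMap_isUnit (S := Localization.Away (f π)) (f π)).pow m
    obtain ⟨x, hx⟩ := hu.dvd (a := algebraMap R (Localization.Away π) r)
    have hyx : (y : Localization.Away (f π)) - φ x = algebraMap A _ (f π ^ n * b) := by
      have h₁ := congrArg φ hx
      have h₂ := congrArg (algebraMap A (Localization.Away (f π))) hb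
      refine hu'.mul_left_cancel ?_
      simp only [map_mul, map_pow, map_sub, hφ'] at h₁ h₂ ⊢
      linear_combination ha + h₂ + h₁
    have hxi : IsIntegral R x := hint x <| by
      rw [← sub_sub_cancel (y : Localization.Away (f π)) (φ x), hyx]
      exact y.2.sub isIntegral_algebraMap
    exact ⟨⟨x, hxi⟩, algebraMap A _ b, Subtype.ext <| hyx.trans <| by simp⟩
  obtain ⟨e, he⟩ := exists_adicCompletion_ringEquiv g _ _ (hgf π) hg_inj hg_surj
  exact ⟨e, fun r ↦ (he _).trans (congrArg _ (hgf r))⟩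

/-- Let `π` be a non-zero-divisor of `R`, `R̄` the integral closure of `R` in
`R[1/π]`, `R̂` the `π`-adic completion of `R`, and `S̄` the integral closure of `R̂` in
`R̂[1/π]`.  Then there is a canonical isomorphism between the `π`-adic completion of `R̄`
and the `π`-adic completion of `S̄`, compatible with the natural maps from `R`. -/
theorem stmt4 {R : Type*} [CommRing R] (π : R) (hπ : π ∈ nonZeroDivisors R) :
    ∃ e : intClAwayCompl R π ≃+*
        intClAwayCompl (AdicCompletion (Ideal.span {π}) R)
          (algebraMap R (AdicCompletion (Ideal.span {π}) R) π),
      ∀ r : R,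
        e (fromBase R π r) =
          fromBase (AdicCompletion (Ideal.span {π}) R)
            (algebraMap R (AdicCompletion (Ideal.span {π}) R) π)
            (algebraMap R (AdicCompletion (Ideal.span {π}) R) r) := by
  exact exists_intClAwayCompl_ringEquiv (algebraMap R (AdicCompletion (Ideal.span {π}) R)) π
    (algebraMap_adicCompletion_mem_nonZeroDivisors π hπ)
    (pow_dvd_of_pow_dvd_algebraMap_adicCompletion π)
    (exists_pow_dvd_sub_algebraMap_adicCompletion π)
end

section
/- Let R be a π-adically complete, π-torsion-free commutative ring (π ∈ R a non-zero-divisor) which is integrally closed in R[1/π], and let f ∈ R. Then the π-adic completion R⟨1/f⟩ of the localization R[1/f] is π-torsion-free and integrally closed in R⟨1/f⟩[1/π]. -/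
/-- `R⟨1/f⟩`: the `π`-adic completion of the localization `R[1/f]` (completion with respect
to the ideal generated by the image of `π`). -/
noncomputable abbrev piComplAway (R : Type*) [CommRing R] (π f : R) : Type _ :=
  AdicCompletion (Ideal.span {algebraMap R (Localization.Away f) π}) (Localization.Away f)

/-- The image of `π` in `R⟨1/f⟩`. -/
noncomputable abbrev piInComplAway (R : Type*) [CommRing R] (π f : R) : piComplAway R π f :=
  algebraMap (Localization.Away f) (piComplAway R π f) (algebraMap R (Localization.Away f) π)

open Polynomial in
/-- Every `a` with `a / s` integral over `A` is divisible by `s`. Integrality of `a / s` is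
phrased inside `A` through `Polynomial.scaleRoots`. -/
def IsIntegrallyClosedDiv {A : Type*} [CommRing A] (s : A) : Prop :=
  ∀ (p : A[X]) (a : A), p.Monic → (p.scaleRoots s).eval a = 0 → s ∣ a

open Polynomial in
theorem Polynomial.Monic.map_scaleRoots {A B : Type*} [CommRing A] [CommRing B] {p : A[X]}
    (hp : p.Monic) (s : A) (φ : A →+* B) :
    (p.scaleRoots s).map φ = (p.map φ).scaleRoots (φ s) := by
  nontriviality B
  exact Polynomial.map_scaleRoots p s φ (by simp [hp.leadingCoeff])

open Polynomial in
theorem IsIntegrallyClosedDiv.dvd_of_pow_dvd_eval {A : Type*} [CommRing A] {s : A}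
    (h : IsIntegrallyClosedDiv s) {p : A[X]} {a : A} (hp : p.Monic) (hd : p.natDegree ≠ 0)
    (hdvd : s ^ p.natDegree ∣ (p.scaleRoots s).eval a) : s ∣ a := by
  obtain ⟨c, hc⟩ := hdvd
  nontriviality A
  have hdeg : (C c).degree < p.degree :=
    degree_C_le.trans_lt (natDegree_pos_iff_degree_pos.mp (Nat.pos_of_ne_zero hd))
  refine h (p - C c) a (hp.sub_of_left hdeg) ?_
  have key : (p - C c).scaleRoots s = p.scaleRoots s - C (c * s ^ p.natDegree) := by
    ext i
    rcases eq_or_ne i 0 with rfl | hi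
    · simp [natDegree_sub_C, sub_mul, -map_mul]
    · simp [natDegree_sub_C, coeff_C_of_ne_zero hi, -map_mul]
  rw [key, eval_sub, eval_C, hc]
  ring

open Polynomial in
theorem isIntegrallyClosedDiv_pow_of_away {A : Type*} [CommRing A] {π : A}
    (hπ : π ∈ nonZeroDivisors A)
    (hic : ∀ x : Localization.Away π, IsIntegral A x →
      x ∈ (algebraMap A (Localization.Away π)).range) (n : ℕ) :
    IsIntegrallyClosedDiv (π ^ n) := by
  intro p a hp h
  have hinj : Function.Injective (algebraMap A (Localization.Away π)) :=
    IsLocalization.injective _ (Submonoid.powers_le.mpr hπ)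
  let t : Submonoid.powers π := ⟨π ^ n, n, rfl⟩
  have hx := IsLocalization.mk'_spec' (Localization.Away π) a t
  have hunit := IsLocalization.map_units (Localization.Away π) t
  obtain ⟨c, hc⟩ := hic (IsLocalization.mk' _ a t) ⟨p, hp, by
    refine (hunit.pow p.natDegree).mul_right_eq_zero.mp ?_
    rw [← scaleRoots_eval₂_mul, hx, eval₂_at_apply, h, map_zero]⟩
  refine ⟨c, hinj ?_⟩
  rw [map_mul, hc]
  exact hx.symm

open Polynomial in
theorem mem_range_algebraMap_away_of_isIntegral {A : Type*} [CommRing A] {π : A}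
    (hπ : π ∈ nonZeroDivisors A) (h : ∀ n : ℕ, IsIntegrallyClosedDiv (π ^ n))
    (x : Localization.Away π) (hx : IsIntegral A x) :
    x ∈ (algebraMap A (Localization.Away π)).range := by
  have hinj : Function.Injective (algebraMap A (Localization.Away π)) :=
    IsLocalization.injective _ (Submonoid.powers_le.mpr hπ)
  obtain ⟨a, t, rfl⟩ := IsLocalization.exists_mk'_eq (Submonoid.powers π) x
  obtain ⟨p, hp, hpx⟩ := hx
  have hroot := scaleRoots_eval₂_eq_zero (s := (t : A)) _ hpx
  rw [IsLocalization.mk'_spec' (Localization.Away π) a t, eval₂_at_apply] at hroot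
  obtain ⟨c, rfl⟩ : (t : A) ∣ a := by
    obtain ⟨n, hn⟩ := t.2
    dsimp only at hn
    rw [← hn] at hroot ⊢
    exact h n p a hp (hinj (hroot.trans (map_zero _).symm))
  refine ⟨c, (IsLocalization.mk'_eq_iff_eq_mul.mpr ?_).symm⟩
  rw [map_mul, mul_comm]

open Polynomial in
theorem IsIntegrallyClosedDiv.of_isLocalization {R : Type*} [CommRing R] (M : Submonoid R)
    (A : Type*) [CommRing A] [Algebra R A] [IsLocalization M A] {s : R}
    (h : IsIntegrallyClosedDiv s) : IsIntegrallyClosedDiv (algebraMap R A s) := by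
  intro p a hp hpa
  rcases eq_or_ne p.natDegree 0 with hd | hd
  · obtain rfl := hp.natDegree_eq_zero.mp hd
    have : (1 : A) = 0 := by simpa using hpa
    exact ⟨0, by rw [mul_zero, ← one_mul a, this, zero_mul]⟩
  have hA : Nontrivial A := by
    by_contra hA
    rw [not_nontrivial_iff_subsingleton] at hA
    exact hd (by rw [Subsingleton.elim p 0, natDegree_zero])
  obtain ⟨q, hqp, hqd, hq⟩ := lifts_and_natDegree_eq_and_monic
    (IsLocalization.scaleRoots_commonDenom_mem_lifts M p (by simp [hp.leadingCoeff]))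
    ((monic_scaleRoots_iff _).mpr hp)
  set u := IsLocalization.commonDenom M p.support p.coeff
  obtain ⟨⟨r, v⟩, hrv⟩ := IsLocalization.surj M a
  have hzero : algebraMap R A (((q.scaleRoots v).scaleRoots s).eval (u * r)) = 0 := by
    have hur : algebraMap R A (u * r) =
        algebraMap R A v * (algebraMap R A u * a) := by
      rw [map_mul, ← hrv]; ring
    rw [← eval₂_at_apply, hur, ← scaleRoots_mul, mul_comm (v : R), scaleRoots_mul,
      scaleRoots_eval₂_mul, ← eval_map, hq.map_scaleRoots, hqp, ← scaleRoots_mul,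
      mul_comm (algebraMap R A u) (algebraMap R A s), scaleRoots_mul, scaleRoots_eval_mul, hpa, mul_zero, mul_zero]
  obtain ⟨w, hw⟩ := (IsLocalization.map_eq_zero_iff M A _).mp hzero
  have hmonic : (q.scaleRoots v).Monic := (monic_scaleRoots_iff _).mpr hq
  have hdvd : s ∣ w * (u * r) := by
    refine h ((q.scaleRoots v).scaleRoots w) _ ((monic_scaleRoots_iff _).mpr hmonic) ?_
    rw [← scaleRoots_mul, mul_comm (w : R) s, scaleRoots_mul, scaleRoots_eval_mul]
    obtain ⟨k, hk⟩ := Nat.exists_eq_succ_of_ne_zero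
      (show ((q.scaleRoots (v : R)).scaleRoots s).natDegree ≠ 0 by
        simpa [natDegree_scaleRoots, hqd] using hd)
    rw [hk, pow_succ, mul_assoc, hw, mul_zero]
  have hunit : IsUnit (algebraMap R A (w * u * v : M)) := IsLocalization.map_units A _
  refine (hunit.dvd_mul_left).mp ?_
  have := map_dvd (algebraMap R A) hdvd
  convert this using 1
  simp only [Submonoid.coe_mul, map_mul, ← hrv]
  ring

theorem AdicCompletion.dvd_of_evalₐ_eq_zero {A : Type*} [CommRing A] {π : A} {n : ℕ}
    {x : AdicCompletion (Ideal.span {π}) A} (hx : AdicCompletion.evalₐ (Ideal.span {π}) n x = 0) :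
    algebraMap A (AdicCompletion (Ideal.span {π}) A) π ^ n ∣ x := by
  have hfg : (Ideal.span {π}).FG := ⟨{π}, by simp⟩
  have hx' : x ∈ (AdicCompletion.eval (Ideal.span {π}) A n).ker := by
    obtain ⟨a, rfl⟩ := AdicCompletion.mk_surjective _ _ x
    rw [AdicCompletion.evalₐ_mk, Ideal.Quotient.eq_zero_iff_mem] at hx
    refine (Submodule.Quotient.mk_eq_zero _).mpr ?_
    simpa using hx
  rw [← AdicCompletion.pow_smul_top_eq_ker_eval hfg, Ideal.span_singleton_pow,
    Submodule.ideal_span_singleton_smul, Submodule.mem_smul_pointwise_iff_exists] at hx'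
  obtain ⟨y, -, rfl⟩ := hx'
  exact ⟨y, by rw [Algebra.smul_def, map_pow]⟩

theorem AdicCompletion.algebraMap_mem_nonZeroDivisors {A : Type*} [CommRing A] {π : A}
    (hπ : π ∈ nonZeroDivisors A) :
    algebraMap A (AdicCompletion (Ideal.span {π}) A) π ∈
      nonZeroDivisors (AdicCompletion (Ideal.span {π}) A) := by
  rw [mem_nonZeroDivisors_iff_right]
  intro x hx
  obtain ⟨a, rfl⟩ := AdicCompletion.mk_surjective _ _ x
  refine AdicCompletion.ext_evalₐ fun n ↦ ?_
  have h : Ideal.Quotient.mk (Ideal.span {π} ^ (n + 1)) (a.val (n + 1) * π) = 0 := by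
    rw [map_mul, ← AdicCompletion.evalₐ_mk]
    refine Eq.trans ?_ ((congrArg (AdicCompletion.evalₐ _ (n + 1)) hx).trans (_root_.map_zero _))
    exact ((map_mul _ _ _).trans (congrArg _ (AlgHom.commutes _ _))).symm
  rw [Ideal.Quotient.eq_zero_iff_mem, Ideal.span_singleton_pow, Ideal.mem_span_singleton] at h
  obtain ⟨c, hc⟩ := h
  have hac : a.val (n + 1) = π ^ n * c := by
    rw [← mul_cancel_right_mem_nonZeroDivisors hπ, hc]
    ring
  refine Eq.trans ?_ (_root_.map_zero _).symm
  rw [AdicCompletion.evalₐ_mk, ← AdicCompletion.Ideal.mk_eq_mk _ n.le_succ, hac,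
    Ideal.Quotient.eq_zero_iff_mem, Ideal.span_singleton_pow, Ideal.mem_span_singleton]
  exact dvd_mul_right _ _

open Polynomial in
theorem IsIntegrallyClosedDiv.adicCompletion {A : Type*} [CommRing A] {π : A} {n : ℕ}
    (h : IsIntegrallyClosedDiv (π ^ n)) :
    IsIntegrallyClosedDiv (algebraMap A (AdicCompletion (Ideal.span {π}) A) π ^ n) := by
  intro p b hp hpb
  let I := Ideal.span {π}
  rcases eq_or_ne p.natDegree 0 with hd | hd
  · obtain rfl := hp.natDegree_eq_zero.mp hd
    have : (1 : AdicCompletion I A) = 0 := by simpa using hpb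
    exact ⟨0, by rw [mul_zero, ← one_mul b, this, zero_mul]⟩
  set N := n * p.natDegree
  have hnN : n ≤ N := Nat.le_mul_of_pos_right n (Nat.pos_of_ne_zero hd)
  let ε : AdicCompletion I A →+* A ⧸ I ^ N := (AdicCompletion.evalₐ I N : _ →+* _)
  have hε (x : A) : ε (algebraMap A _ x) = Ideal.Quotient.mk _ x :=
    (AdicCompletion.evalₐ I N).commutes x
  obtain ⟨a, ha⟩ := Ideal.Quotient.mk_surjective (ε b)
  have hker : algebraMap A (AdicCompletion I A) π ^ n ∣ b - algebraMap A _ a :=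
    (pow_dvd_pow _ hnN).trans <| AdicCompletion.dvd_of_evalₐ_eq_zero <|
      show ε _ = 0 by rw [map_sub, hε, ha, sub_self]
  rcases subsingleton_or_nontrivial (A ⧸ I ^ N) with hsub | hnt
  · exact (pow_dvd_pow _ hnN).trans <| AdicCompletion.dvd_of_evalₐ_eq_zero <|
      Subsingleton.elim (α := A ⧸ I ^ N) _ _
  obtain ⟨q, hqp, hqd, hq⟩ := lifts_and_natDegree_eq_and_monic
    (f := Ideal.Quotient.mk (I ^ N)) (p := p.map ε)
    (map_surjective _ Ideal.Quotient.mk_surjective _) (hp.map ε)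
  rw [hp.natDegree_map] at hqd
  have hdvd : π ^ n ∣ a := by
    refine h.dvd_of_pow_dvd_eval hq (hqd ▸ hd) ?_
    rw [hqd, ← pow_mul, ← Ideal.mem_span_singleton, ← Ideal.span_singleton_pow,
      ← Ideal.Quotient.eq_zero_iff_mem, ← eval₂_at_apply, ← eval_map, hq.map_scaleRoots, hqp, ha,
      ← hε, map_pow, map_pow, ← map_pow, ← hp.map_scaleRoots, eval_map, eval₂_at_apply, hpb,
      map_zero]
  have := map_dvd (algebraMap A (AdicCompletion I A)) hdvd
  rw [map_pow] at this
  simpa using dvd_add hker this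

/-- Let `R` be a `π`-adically complete, `π`-torsion-free commutative ring
(`π` a non-zero-divisor) which is integrally closed in `R[1/π]`, and let `f ∈ R`.  Then
the `π`-adic completion `R⟨1/f⟩` of `R[1/f]` is `π`-torsion-free and integrally closed in
`R⟨1/f⟩[1/π]`. -/
theorem stmt5 {R : Type*} [CommRing R] (π : R) (hπ : π ∈ nonZeroDivisors R)
    [IsAdicComplete (Ideal.span {π}) R]
    (hic : ∀ x : Localization.Away π, IsIntegral R x →
      x ∈ (algebraMap R (Localization.Away π)).range)
    (f : R) :
    piInComplAway R π f ∈ nonZeroDivisors (piComplAway R π f) ∧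
      ∀ x : Localization.Away (piInComplAway R π f),
        IsIntegral (piComplAway R π f) x →
          x ∈ (algebraMap (piComplAway R π f)
            (Localization.Away (piInComplAway R π f))).range := by
  have hπA : algebraMap R (Localization.Away f) π ∈ nonZeroDivisors (Localization.Away f) :=
    IsLocalization.map_nonZeroDivisors_le (Submonoid.powers f) _ ⟨π, hπ, rfl⟩
  have hπC := AdicCompletion.algebraMap_mem_nonZeroDivisors hπA
  have hA (n : ℕ) : IsIntegrallyClosedDiv (algebraMap R (Localization.Away f) π ^ n) := by
    rw [← map_pow]
    exact (isIntegrallyClosedDiv_pow_of_away hπ hic n).of_isLocalization (Submonoid.powers f) _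
  exact ⟨hπC, mem_range_algebraMap_away_of_isIntegral hπC fun n ↦ (hA n).adicCompletion⟩
end

section
/- Purity of π₀: Let R be a nonzero commutative ring and π ∈ R a non-zero-divisor such that R is π-adically complete and R is integrally closed in R[1/π]. Then the following are equivalent: (i) the prime spectrum Spec(R/πR) is a connected topological space; (ii) Spec(R) is connected; (iii) Spec(R[1/π]) is connected. -/
/-- The spectrum of a commutative ring is connected iff the ring is nontrivial and its only
idempotents are `0` and `1`. -/
theorem PrimeSpectrum.connectedSpace_iff_forall_isIdempotentElem {A : Type*} [CommRing A] :
    ConnectedSpace (PrimeSpectrum A) ↔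
      Nontrivial A ∧ ∀ e : A, IsIdempotentElem e → e = 0 ∨ e = 1 := by
  rw [connectedSpace_iff_clopen, PrimeSpectrum.nonempty_iff_nontrivial]
  refine and_congr_right fun _ => ⟨fun h e he => ?_, fun h s hs => ?_⟩
  · rcases h _ (PrimeSpectrum.isClopen_iff.mpr ⟨e, he, rfl⟩) with h | h
    · refine .inl (PrimeSpectrum.basicOpen_injOn_isIdempotentElem he .zero ?_)
      ext1
      simpa using h
    · refine .inr (PrimeSpectrum.basicOpen_injOn_isIdempotentElem he .one ?_)
      ext1
      simpa using h
  · obtain ⟨e, he, rfl⟩ := PrimeSpectrum.isClopen_iff.mp hs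
    rcases h e he with rfl | rfl <;> simp

/-- A ring homomorphism along which idempotents lift, and which kills no nonzero idempotent,
preserves and reflects connectedness of the spectrum. -/
theorem RingHom.connectedSpace_primeSpectrum_iff {A B : Type*} [CommRing A] [CommRing B]
    (f : A →+* B) (hker : ∀ e : A, IsIdempotentElem e → f e = 0 → e = 0)
    (hlift : ∀ e : B, IsIdempotentElem e → ∃ e' : A, IsIdempotentElem e' ∧ f e' = e) :
    ConnectedSpace (PrimeSpectrum A) ↔ ConnectedSpace (PrimeSpectrum B) := by
  simp only [PrimeSpectrum.connectedSpace_iff_forall_isIdempotentElem]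
  refine and_congr ⟨fun _ => ?_, fun _ => f.domain_nontrivial⟩
    ⟨fun h e he => ?_, fun h e he => ?_⟩
  · refine ⟨0, 1, fun h => one_ne_zero (hker 1 .one ?_)⟩
    rw [map_one, h]
  · obtain ⟨e', he', rfl⟩ := hlift e he
    rcases h e' he' with rfl | rfl <;> simp
  · refine (h (f e) (he.map f)).imp (hker e he) fun h1 => ?_
    exact (sub_eq_zero.mp (hker (1 - e) he.one_sub (by simp [h1]))).symm

theorem IsIdempotentElem.eq_zero_of_mem_jacobson_bot {A : Type*} [CommRing A] {e : A}
    (he : IsIdempotentElem e) (hmem : e ∈ (⊥ : Ideal A).jacobson) : e = 0 := by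
  have hu : IsUnit (1 - e) := by
    have := Ideal.mem_jacobson_bot.mp hmem (-1)
    rwa [mul_neg_one, neg_add_eq_sub] at this
  exact hu.mul_left_eq_zero.mp he.mul_one_sub_self

/-- Idempotents lift along the quotient map of a Henselian pair. -/
theorem HenselianRing.exists_isIdempotentElem_mk_eq {A : Type*} [CommRing A] (I : Ideal A)
    [HenselianRing A I] (e : A ⧸ I) (he : IsIdempotentElem e) :
    ∃ e' : A, IsIdempotentElem e' ∧ Ideal.Quotient.mk I e' = e := by
  obtain ⟨a, rfl⟩ := Ideal.Quotient.mk_surjective e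
  have he' : Ideal.Quotient.mk I a * Ideal.Quotient.mk I a = Ideal.Quotient.mk I a := he
  obtain ⟨e', hroot, hmem⟩ := HenselianRing.is_henselian (I := I)
    (Polynomial.X ^ 2 - Polynomial.X : Polynomial A)
    (Polynomial.monic_X_pow_sub (Polynomial.degree_X_le.trans_lt (by norm_num))) a
    (by
      rw [← Ideal.Quotient.eq_zero_iff_mem]
      simp [pow_two, he'])
    (by
      refine IsUnit.of_mul_eq_one (Ideal.Quotient.mk I (2 * a - 1)) ?_
      simp only [Polynomial.derivative_X_pow, Polynomial.derivative_X,
        Polynomial.eval_sub, Polynomial.eval_mul, Polynomial.eval_pow, Polynomial.eval_X,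
        Polynomial.eval_ofNat, Polynomial.eval_one, map_sub, map_mul, map_one, map_pow, map_ofNat,
        Nat.cast_ofNat]
      linear_combination 4 * he')
  refine ⟨e', ?_, Ideal.Quotient.eq.mpr hmem⟩
  have : e' ^ 2 - e' = 0 := by simpa using hroot
  rw [IsIdempotentElem, ← pow_two, sub_eq_zero.mp this]

theorem IsIdempotentElem.isIntegral {A B : Type*} [CommRing A] [CommRing B] [Algebra A B] {e : B}
    (he : IsIdempotentElem e) : IsIntegral A e :=
  ⟨Polynomial.X ^ 2 - Polynomial.X,
    Polynomial.monic_X_pow_sub (Polynomial.degree_X_le.trans_lt (by norm_num)),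
    by simp [pow_two, he.eq]⟩

/-- Purity of `π₀`: Let `R` be a nonzero commutative ring and `π ∈ R` a
non-zero-divisor such that `R` is `π`-adically complete and integrally closed in `R[1/π]`.
Then `Spec (R/πR)` is connected iff `Spec R` is connected iff `Spec (R[1/π])` is
connected. -/
theorem stmt7 {R : Type*} [CommRing R] [Nontrivial R] (π : R) (hπ : π ∈ nonZeroDivisors R)
    [IsAdicComplete (Ideal.span {π}) R]
    (hic : ∀ x : Localization.Away π, IsIntegral R x →
      x ∈ (algebraMap R (Localization.Away π)).range) :
    List.TFAE
      [ConnectedSpace (PrimeSpectrum (R ⧸ Ideal.span {π})),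
       ConnectedSpace (PrimeSpectrum R),
       ConnectedSpace (PrimeSpectrum (Localization.Away π))] := by
  tfae_have 2 ↔ 1 := by
    refine (Ideal.Quotient.mk (Ideal.span {π})).connectedSpace_primeSpectrum_iff
      (fun e he h0 => ?_) (HenselianRing.exists_isIdempotentElem_mk_eq _)
    exact he.eq_zero_of_mem_jacobson_bot
      (IsAdicComplete.le_jacobson_bot _ (Ideal.Quotient.eq_zero_iff_mem.mp h0))
  tfae_have 2 ↔ 3 := by
    have hinj : Function.Injective (algebraMap R (Localization.Away π)) :=
      IsLocalization.injective _ (Submonoid.powers_le.mpr hπ)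
    refine (algebraMap R (Localization.Away π)).connectedSpace_primeSpectrum_iff
      (fun e _ h0 => hinj (h0.trans (map_zero _).symm)) fun e he => ?_
    obtain ⟨e', rfl⟩ := hic e he.isIntegral
    exact ⟨e', hinj (by simpa using he.eq), rfl⟩
  tfae_finish
end

section
/- Let O be a commutative ring, π ∈ O, and let M and N be O-modules that are π-adically complete. Let u, v : M → N be O-linear maps with u ≡ v mod π², i.e. u(m) − v(m) ∈ π²·N for all m ∈ M. Then the cokernel of u is annihilated by π (that is, π·n ∈ u(M) for all n ∈ N) if and only if the cokernel of v is annihilated by π; and when this is the case, the images coincide: u(M) = v(M). -/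
section

variable {O M N : Type*} [CommRing O] [AddCommGroup M] [Module O M] [AddCommGroup N] [Module O N]

theorem mem_span_singleton_pow_smul_top_iff (π : O) (k : ℕ) (x : M) :
    x ∈ (Ideal.span {π} ^ k • ⊤ : Submodule O M) ↔ ∃ y : M, π ^ k • y = x := by
  rw [Ideal.span_singleton_pow, Submodule.ideal_span_singleton_smul,
    Submodule.mem_smul_pointwise_iff_exists]
  simp

/-- If `u - v` takes values in `π • u(M)`, then `v(M) ⊆ u(M)`. -/
theorem LinearMap.range_le_range_of_sub_eq_smul {π : O} {u v : M →ₗ[O] N}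
    (h : ∀ m, ∃ m', u m - v m = π • u m') : LinearMap.range v ≤ LinearMap.range u := by
  rintro _ ⟨m, rfl⟩
  obtain ⟨m', hm'⟩ := h m
  exact ⟨m - π • m', by rw [map_sub, map_smul, ← hm', sub_sub_cancel]⟩

/-- If `u - v` takes values in `π • u(M)`, then `u(M) ⊆ v(M)` by successive approximation. -/
theorem LinearMap.range_le_range_of_sub_eq_smul_of_isPrecomplete {π : O}
    [IsPrecomplete (Ideal.span {π}) M] [IsHausdorff (Ideal.span {π}) N] {u v : M →ₗ[O] N}
    (h : ∀ m, ∃ m', u m - v m = π • u m') : LinearMap.range u ≤ LinearMap.range v := by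
  choose g hg using h
  rintro _ ⟨m, rfl⟩
  let f : ℕ → M := fun k => ∑ i ∈ Finset.range k, π ^ i • g^[i] m
  have hf (k : ℕ) : u m - v (f k) = π ^ k • u (g^[k] m) := by
    induction k with
    | zero => simp [f]
    | succ k ih =>
      rw [show f (k + 1) = f k + π ^ k • g^[k] m from Finset.sum_range_succ _ _, map_add,
        ← sub_sub, ih, map_smul, ← smul_sub, hg, Function.iterate_succ_apply', pow_succ, mul_smul]
  obtain ⟨L, hL⟩ := IsPrecomplete.prec' (I := Ideal.span {π}) f fun {a b} hab => by
    refine SModEq.symm (SModEq.sub_mem.2 ?_)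
    rw [show f b - f a = ∑ i ∈ Finset.Ico a b, π ^ i • g^[i] m from
      (Finset.sum_Ico_eq_sub _ hab).symm]
    refine Submodule.sum_mem _ fun i hi => (mem_span_singleton_pow_smul_top_iff π a _).2
      ⟨π ^ (i - a) • g^[i] m, ?_⟩
    rw [smul_smul, ← pow_add, Nat.add_sub_cancel' (Finset.mem_Ico.1 hi).1]
  refine ⟨L, (sub_eq_zero.1 ?_).symm⟩
  refine IsHausdorff.haus' (I := Ideal.span {π}) _ fun k => SModEq.zero.2 ?_
  obtain ⟨y, hy⟩ := (mem_span_singleton_pow_smul_top_iff π k _).1 (SModEq.sub_mem.1 (hL k))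
  refine (mem_span_singleton_pow_smul_top_iff π k _).2 ⟨u (g^[k] m) + v y, ?_⟩
  rw [smul_add, ← hf, ← map_smul, hy, map_sub, sub_add_sub_cancel]

/-- If `u ≡ v` modulo `π ^ 2` and `π` kills the cokernel of `u`, then `u(M) = v(M)`. -/
theorem LinearMap.range_eq_range_of_sub_eq_sq_smul {π : O}
    [IsPrecomplete (Ideal.span {π}) M] [IsHausdorff (Ideal.span {π}) N] {u v : M →ₗ[O] N}
    (huv : ∀ m, ∃ n : N, u m - v m = π ^ 2 • n) (hu : ∀ n : N, π • n ∈ LinearMap.range u) :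
    LinearMap.range u = LinearMap.range v := by
  have h (m : M) : ∃ m', u m - v m = π • u m' := by
    obtain ⟨n, hn⟩ := huv m
    obtain ⟨m', hm'⟩ := hu n
    exact ⟨m', by rw [hn, hm', smul_smul, sq]⟩
  exact le_antisymm (range_le_range_of_sub_eq_smul_of_isPrecomplete h)
    (range_le_range_of_sub_eq_smul h)

end

/-- Let `O` be a commutative ring, `π ∈ O`, and `M`, `N` two `π`-adically
complete `O`-modules.  Let `u, v : M → N` be `O`-linear maps with `u ≡ v mod π²`.  Then
the cokernel of `u` is annihilated by `π` iff the cokernel of `v` is, and in that case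
`u(M) = v(M)`. -/
theorem stmt8 {O M N : Type*} [CommRing O] (π : O)
    [AddCommGroup M] [Module O M] [AddCommGroup N] [Module O N]
    [IsAdicComplete (Ideal.span {π}) M] [IsAdicComplete (Ideal.span {π}) N]
    (u v : M →ₗ[O] N)
    (huv : ∀ m : M, ∃ n : N, u m - v m = π ^ 2 • n) :
    ((∀ n : N, π • n ∈ LinearMap.range u) ↔ (∀ n : N, π • n ∈ LinearMap.range v)) ∧
      ((∀ n : N, π • n ∈ LinearMap.range u) → LinearMap.range u = LinearMap.range v) := by
  have hvu (m : M) : ∃ n : N, v m - u m = π ^ 2 • n := by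
    obtain ⟨n, hn⟩ := huv m
    exact ⟨-n, by rw [smul_neg, ← hn, neg_sub]⟩
  refine ⟨⟨fun h => ?_, fun h => ?_⟩, LinearMap.range_eq_range_of_sub_eq_sq_smul huv⟩
  · rwa [← LinearMap.range_eq_range_of_sub_eq_sq_smul huv h]
  · rwa [← LinearMap.range_eq_range_of_sub_eq_sq_smul hvu h]
end

section
/- Let R be a commutative ring, r a natural number, A an r×r matrix over R, and t ∈ R. If the cokernel of the R-linear map R^r → R^r given by v ↦ A·v is annihilated by t (i.e. for every v ∈ R^r there exists w ∈ R^r with A·w = t·v), then t^r belongs to the principal ideal of R generated by det A. -/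
/-- If the cokernel of the linear map `v ↦ A · v` on `R^r` given by a square
matrix `A` is annihilated by `t`, then `t ^ r` lies in the principal ideal generated by
`det A`. -/
theorem stmt9 {R : Type*} [CommRing R] (r : ℕ) (A : Matrix (Fin r) (Fin r) R) (t : R)
    (h : ∀ v : Fin r → R, ∃ w : Fin r → R, A.mulVec w = t • v) :
    t ^ r ∈ Ideal.span {A.det} := by
  choose f hf using h
  have hB : A * (Matrix.of fun i j => f (Pi.single j 1) i) = t • (1 : Matrix (Fin r) (Fin r) R) := by
    ext i j
    have := congrFun (hf (Pi.single j 1)) i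
    simpa [Matrix.mul_apply, Matrix.mulVec, dotProduct, Matrix.one_apply, Pi.single_apply]
      using this
  rw [Ideal.mem_span_singleton]
  refine ⟨(Matrix.of fun i j => f (Pi.single j 1) i).det, ?_⟩
  rw [← Matrix.det_mul, hB, Matrix.det_smul, Matrix.det_one, mul_one, Fintype.card_fin]
end

section
/- Let O be a commutative ring, π ∈ O, and ((R_m), (φ_{m,m'})) a directed system of commutative O-algebras such that each R_m is π-torsion-free and integrally closed in R_m[1/π]. Let R_∞ = colim_m R_m and let R̂_∞ be the π-adic completion of R_∞. Then R̂_∞ is π-torsion-free and integrally closed in R̂_∞[1/π]. -/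
/-- An elementary form of the condition that `R` is integrally closed in `R[1/p]`: if `x / p`
satisfies a monic equation over `R` (written here with denominators cleared), then `p ∣ x`. -/
def IsDivIntegrallyClosed (R : Type*) [CommRing R] (p : R) : Prop :=
  ∀ (x : R) (d : ℕ) (q : Polynomial R),
    x ^ d + ∑ i ∈ Finset.range d, q.coeff i * p ^ (d - i) * x ^ i = 0 → p ∣ x

theorem pow_mul_monic_eq {S : Type*} [CommRing S] (p y : S) (d : ℕ) (c : ℕ → S) :
    (p * y) ^ d + ∑ i ∈ Finset.range d, c i * p ^ (d - i) * (p * y) ^ i =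
      p ^ d * (y ^ d + ∑ i ∈ Finset.range d, c i * y ^ i) := by
  rw [mul_add, Finset.mul_sum, mul_pow]
  congr 1
  refine Finset.sum_congr rfl fun i hi ↦ ?_
  rw [mul_pow, ← Nat.sub_add_cancel (Finset.mem_range.mp hi).le, pow_add, Nat.add_sub_cancel]
  ring

theorem isDivIntegrallyClosed_of_away {R : Type*} [CommRing R] {p : R}
    (hp : p ∈ nonZeroDivisors R)
    (h : ∀ x : Localization.Away p, IsIntegral R x →
      x ∈ (algebraMap R (Localization.Away p)).range) :
    IsDivIntegrallyClosed R p := by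
  intro x d q hx
  have hinj : Function.Injective (algebraMap R (Localization.Away p)) :=
    IsLocalization.injective _ (Submonoid.powers_le.mpr hp)
  have hu : IsUnit (algebraMap R (Localization.Away p) p) :=
    IsLocalization.Away.algebraMap_isUnit p
  obtain ⟨y, hy⟩ : ∃ y, algebraMap R (Localization.Away p) p * y = algebraMap R _ x :=
    hu.dvd.imp fun _ ↦ Eq.symm
  have key : y ^ d + ∑ i ∈ Finset.range d, algebraMap R _ (q.coeff i) * y ^ i = 0 := by
    refine (hu.pow d).mul_right_eq_zero.mp ?_
    rw [← pow_mul_monic_eq, hy]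
    simpa using congrArg (algebraMap R (Localization.Away p)) hx
  have hint : IsIntegral R y := by
    refine ⟨Polynomial.X ^ d + ∑ i ∈ Finset.range d, Polynomial.C (q.coeff i) * Polynomial.X ^ i,
      Polynomial.monic_X_pow_add ?_, ?_⟩
    · refine (Polynomial.degree_sum_le _ _).trans_lt ?_
      refine (Finset.sup_lt_iff (WithBot.bot_lt_coe d)).mpr fun i hi ↦ ?_
      exact (Polynomial.degree_C_mul_X_pow_le _ _).trans_lt
        (WithBot.coe_lt_coe.mpr (Finset.mem_range.mp hi))
    · simpa [Polynomial.eval₂_finsetSum] using key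
  obtain ⟨r, rfl⟩ := h y hint
  rw [← map_mul] at hy
  exact ⟨r, (hinj hy).symm⟩

theorem IsDivIntegrallyClosed.mem_range_of_isIntegral {R : Type*} [CommRing R] {p : R}
    (hp : p ∈ nonZeroDivisors R) (h : IsDivIntegrallyClosed R p)
    (x : Localization.Away p) (hx : IsIntegral R x) :
    x ∈ (algebraMap R (Localization.Away p)).range := by
  have hinj : Function.Injective (algebraMap R (Localization.Away p)) :=
    IsLocalization.injective _ (Submonoid.powers_le.mpr hp)
  have hu : IsUnit (algebraMap R (Localization.Away p) p) :=
    IsLocalization.Away.algebraMap_isUnit p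
  have step (y : Localization.Away p) (hy : IsIntegral R y) (a : R)
      (ha : algebraMap R _ p * y = algebraMap R _ a) :
      y ∈ (algebraMap R (Localization.Away p)).range := by
    obtain ⟨q, hq, hqy⟩ := hy
    have : p ∣ a := by
      refine h a q.natDegree q (hinj ?_)
      have := pow_mul_monic_eq (algebraMap R _ p) y q.natDegree
        (fun i ↦ algebraMap R _ (q.coeff i))
      rw [ha] at this
      rw [hq.as_sum] at hqy
      simp only [Polynomial.eval₂_add, Polynomial.eval₂_finsetSum, Polynomial.eval₂_mul,
        Polynomial.eval₂_C, Polynomial.eval₂_X_pow] at hqy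
      rw [hqy, mul_zero] at this
      simpa using this
    obtain ⟨b, rfl⟩ := this
    rw [map_mul] at ha
    exact ⟨b, (hu.mul_left_cancel ha).symm⟩
  have descend (k : ℕ) : ∀ y : Localization.Away p, IsIntegral R y →
      algebraMap R _ p ^ k * y ∈ (algebraMap R (Localization.Away p)).range →
      y ∈ (algebraMap R (Localization.Away p)).range := by
    induction k with
    | zero => intro y _ hy; simpa using hy
    | succ k ih =>
      rintro y hy ⟨a, ha⟩
      have hi : IsIntegral R (algebraMap R (Localization.Away p) p ^ k * y) :=
        (isIntegral_algebraMap.pow k).mul hy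
      exact ih y hy (step _ hi a (by rw [ha]; ring))
  refine descend (IsLocalization.Away.sec p x).2 x hx ⟨(IsLocalization.Away.sec p x).1, ?_⟩
  rw [← IsLocalization.Away.sec_spec, map_pow, mul_comm]

namespace AdicCompletion

theorem exists_seq_evalₐ_eq {R : Type*} [CommRing R] (I : Ideal R) (x : AdicCompletion I R) :
    ∃ s : ℕ → R, (∀ n, evalₐ I n x = Ideal.Quotient.mk (I ^ n) (s n)) ∧
      ∀ m n, m ≤ n → Ideal.Quotient.mk (I ^ m) (s n) = Ideal.Quotient.mk (I ^ m) (s m) := by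
  obtain ⟨s, rfl⟩ := mk_surjective _ _ x
  exact ⟨s.val, fun n ↦ evalₐ_mk I n s, fun m n h ↦ Ideal.mk_eq_mk I h s⟩

theorem algebraMap_mem_nonZeroDivisors_s13 {R : Type*} [CommRing R] {p : R}
    (hp : p ∈ nonZeroDivisors R) :
    algebraMap R (AdicCompletion (Ideal.span {p}) R) p ∈
      nonZeroDivisors (AdicCompletion (Ideal.span {p}) R) := by
  rw [mem_nonZeroDivisors_iff_right]
  intro x hx
  obtain ⟨s, hxs, hs⟩ := exists_seq_evalₐ_eq _ x
  refine ext_evalₐ fun n ↦ ?_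
  have h := (congrArg (evalₐ (Ideal.span {p}) (n + 1)) hx).trans (_root_.map_zero _)
  rw [map_mul, AlgHom.commutes, hxs, Ideal.Quotient.algebraMap_eq, ← map_mul,
    Ideal.Quotient.eq_zero_iff_mem, Ideal.span_singleton_pow, Ideal.mem_span_singleton,
    pow_succ] at h
  have h' : p ^ n ∣ s (n + 1) := by
    obtain ⟨c, hc⟩ := h
    refine ⟨c, (mul_cancel_right_mem_nonZeroDivisors hp).mp ?_⟩
    rw [hc]; ring
  rw [_root_.map_zero, hxs, ← hs _ _ n.le_succ, Ideal.Quotient.eq_zero_iff_mem,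
    Ideal.span_singleton_pow, Ideal.mem_span_singleton]
  exact h'

theorem isDivIntegrallyClosed {R : Type*} [CommRing R] {p : R}
    (h : IsDivIntegrallyClosed R p) :
    IsDivIntegrallyClosed (AdicCompletion (Ideal.span {p}) R) (algebraMap R _ p) := by
  intro x d q hx
  rcases Nat.eq_zero_or_pos d with rfl | hd
  · have h1 : (1 : AdicCompletion (Ideal.span {p}) R) = 0 := by simpa using hx
    exact ⟨x, by rw [← one_mul x, h1]; simp⟩
  obtain ⟨s, hxs, hs⟩ := exists_seq_evalₐ_eq _ x
  obtain ⟨q₀, hq₀⟩ := Polynomial.map_surjective _ Ideal.Quotient.mk_surjective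
    (q.map (evalₐ (Ideal.span {p}) d : _ →+* R ⧸ Ideal.span {p} ^ d))
  have hc (i : ℕ) : evalₐ (Ideal.span {p}) d (q.coeff i) = Ideal.Quotient.mk _ (q₀.coeff i) := by
    simpa using (congrArg (fun r ↦ r.coeff i) hq₀).symm
  have hmem := (congrArg (evalₐ (Ideal.span {p}) d) hx).trans (_root_.map_zero _)
  simp only [map_add, map_sum, map_mul, map_pow, hc, hxs, AlgHom.commutes,
    Ideal.Quotient.algebraMap_eq] at hmem
  simp only [← map_pow, ← map_mul, ← map_sum, ← map_add] at hmem
  rw [Ideal.Quotient.eq_zero_iff_mem, Ideal.span_singleton_pow, Ideal.mem_span_singleton] at hmem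
  obtain ⟨e, he⟩ := hmem
  have hdvd : p ∣ s d := by
    refine h _ d (q₀ - Polynomial.C e) ?_
    have hC : ∑ i ∈ Finset.range d, (Polynomial.C e).coeff i * p ^ (d - i) * s d ^ i =
        p ^ d * e := by
      rw [Finset.sum_eq_single_of_mem 0 (Finset.mem_range.mpr hd)]
      · simp [mul_comm]
      · intro i _ hi
        simp [Polynomial.coeff_C, hi]
    simp only [Polynomial.coeff_sub, sub_mul, Finset.sum_sub_distrib, hC]
    rw [← he]; ring
  have hker : x ∈ RingHom.ker (evalOneₐ (Ideal.span {p})).toRingHom := by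
    change evalOneₐ (Ideal.span {p}) x = 0
    rw [← factorₐ_evalₐ_one, hxs, ← hs 1 d hd, Ideal.Quotient.factor_mk,
      Ideal.Quotient.eq_zero_iff_mem, Ideal.mem_span_singleton]
    exact hdvd
  rw [ker_evalOneₐ_eq_map _ (Submodule.fg_span_singleton p), Ideal.map_span,
    Set.image_singleton, Ideal.mem_span_singleton] at hker
  exact hker

end AdicCompletion

section DirectLimit

variable {ι : Type*} [Preorder ι] [IsDirected ι (· ≤ ·)] [Nonempty ι]
  {G : ι → Type*} [∀ i, CommRing (G i)] {f : ∀ i j, i ≤ j → G i →+* G j}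
  [DirectedSystem G fun i j h => ⇑(f i j h)]
  {p : ∀ i, G i} {p' : Ring.DirectLimit G fun i j h => ⇑(f i j h)}

theorem Ring.DirectLimit.mem_nonZeroDivisors
    (hf : ∀ i j (h : i ≤ j), f i j h (p i) = p j)
    (hp' : ∀ i, Ring.DirectLimit.of G (fun i j h => ⇑(f i j h)) i (p i) = p')
    (hp : ∀ i, p i ∈ nonZeroDivisors (G i)) :
    p' ∈ nonZeroDivisors (Ring.DirectLimit G fun i j h => ⇑(f i j h)) := by
  rw [mem_nonZeroDivisors_iff_right]
  intro x hx
  obtain ⟨i, x, rfl⟩ := Ring.DirectLimit.exists_of x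
  rw [← hp' i, ← map_mul] at hx
  obtain ⟨j, hij, hj⟩ := Ring.DirectLimit.of.zero_exact hx
  rw [map_mul, hf] at hj
  rw [← Ring.DirectLimit.of_f hij, (mem_nonZeroDivisors_iff_right.mp (hp j)) _ hj, map_zero]

theorem Ring.DirectLimit.isDivIntegrallyClosed
    (hf : ∀ i j (h : i ≤ j), f i j h (p i) = p j)
    (hp' : ∀ i, Ring.DirectLimit.of G (fun i j h => ⇑(f i j h)) i (p i) = p')
    (hp : ∀ i, IsDivIntegrallyClosed (G i) (p i)) :
    IsDivIntegrallyClosed (Ring.DirectLimit G fun i j h => ⇑(f i j h)) p' := by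
  intro x d q hx
  obtain ⟨i₁, x, rfl⟩ := Ring.DirectLimit.exists_of x
  obtain ⟨i₂, q, rfl⟩ := Ring.DirectLimit.Polynomial.exists_of q
  obtain ⟨i, h₁, h₂⟩ := exists_ge_ge i₁ i₂
  have hx' : Ring.DirectLimit.of G (fun i j h => ⇑(f i j h)) i
      (f i₁ i h₁ x ^ d + ∑ k ∈ Finset.range d,
        (q.map (f i₂ i h₂)).coeff k * p i ^ (d - k) * f i₁ i h₁ x ^ k) = 0 := by
    simpa [hp'] using hx
  obtain ⟨j, hij, hj⟩ := Ring.DirectLimit.of.zero_exact hx'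
  have hdvd : p j ∣ f i j hij (f i₁ i h₁ x) := by
    refine hp j _ d ((q.map (f i₂ i h₂)).map (f i j hij)) ?_
    simpa [hf] using hj
  simpa [hp'] using map_dvd (Ring.DirectLimit.of G (fun i j h => ⇑(f i j h)) j) hdvd

end DirectLimit


/-- Let `((R_m), (φ))` be a directed system of commutative `O`-algebras,
each `R_m` being `π`-torsion-free and integrally closed in `R_m[1/π]` (where `π` denotes
the image of a fixed `π ∈ O`).  Let `R_∞` be the direct limit and `R̂_∞` its `π`-adic
completion.  Then `R̂_∞` is `π`-torsion-free and integrally closed in `R̂_∞[1/π]`. -/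
theorem stmt13 {O : Type*} [CommRing O] (π : O)
    {ι : Type*} [Preorder ι] [IsDirected ι (· ≤ ·)] [Nonempty ι]
    (G : ι → Type*) [∀ i, CommRing (G i)] [∀ i, Algebra O (G i)]
    (f : ∀ i j, i ≤ j → G i →+* G j)
    [DirectedSystem G fun i j h => ⇑(f i j h)]
    (hf : ∀ i j (h : i ≤ j) (o : O), f i j h (algebraMap O (G i) o) = algebraMap O (G j) o)
    (htf : ∀ i, algebraMap O (G i) π ∈ nonZeroDivisors (G i))
    (hic : ∀ i, ∀ x : Localization.Away (algebraMap O (G i) π),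
      IsIntegral (G i) x →
        x ∈ (algebraMap (G i) (Localization.Away (algebraMap O (G i) π))).range)
    (i₀ : ι) :
    (algebraMap (Ring.DirectLimit G fun i j h => ⇑(f i j h))
        (AdicCompletion
          (Ideal.span {Ring.DirectLimit.of G (fun i j h => ⇑(f i j h)) i₀
            (algebraMap O (G i₀) π)})
          (Ring.DirectLimit G fun i j h => ⇑(f i j h)))
        (Ring.DirectLimit.of G (fun i j h => ⇑(f i j h)) i₀ (algebraMap O (G i₀) π)) ∈
      nonZeroDivisors
        (AdicCompletion
          (Ideal.span {Ring.DirectLimit.of G (fun i j h => ⇑(f i j h)) i₀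
            (algebraMap O (G i₀) π)})
          (Ring.DirectLimit G fun i j h => ⇑(f i j h)))) ∧
      ∀ x : Localization.Away
          (algebraMap (Ring.DirectLimit G fun i j h => ⇑(f i j h))
            (AdicCompletion
              (Ideal.span {Ring.DirectLimit.of G (fun i j h => ⇑(f i j h)) i₀
                (algebraMap O (G i₀) π)})
              (Ring.DirectLimit G fun i j h => ⇑(f i j h)))
            (Ring.DirectLimit.of G (fun i j h => ⇑(f i j h)) i₀ (algebraMap O (G i₀) π))),
        IsIntegral
            (AdicCompletion
              (Ideal.span {Ring.DirectLimit.of G (fun i j h => ⇑(f i j h)) i₀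
                (algebraMap O (G i₀) π)})
              (Ring.DirectLimit G fun i j h => ⇑(f i j h))) x →
          x ∈ (algebraMap
            (AdicCompletion
              (Ideal.span {Ring.DirectLimit.of G (fun i j h => ⇑(f i j h)) i₀
                (algebraMap O (G i₀) π)})
              (Ring.DirectLimit G fun i j h => ⇑(f i j h)))
            (Localization.Away
              (algebraMap (Ring.DirectLimit G fun i j h => ⇑(f i j h))
                (AdicCompletion
                  (Ideal.span {Ring.DirectLimit.of G (fun i j h => ⇑(f i j h)) i₀
                    (algebraMap O (G i₀) π)})
                  (Ring.DirectLimit G fun i j h => ⇑(f i j h)))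
                (Ring.DirectLimit.of G (fun i j h => ⇑(f i j h)) i₀
                  (algebraMap O (G i₀) π))))).range := by
  have hof (i : ι) : Ring.DirectLimit.of G (fun i j h => ⇑(f i j h)) i (algebraMap O (G i) π) =
      Ring.DirectLimit.of G (fun i j h => ⇑(f i j h)) i₀ (algebraMap O (G i₀) π) := by
    obtain ⟨j, hij, h0j⟩ := exists_ge_ge i i₀
    rw [← Ring.DirectLimit.of_f hij, ← Ring.DirectLimit.of_f h0j, hf, hf]
  have hnzd := AdicCompletion.algebraMap_mem_nonZeroDivisors_s13
    (Ring.DirectLimit.mem_nonZeroDivisors (fun i j h ↦ hf i j h π) hof htf)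
  exact ⟨hnzd, (AdicCompletion.isDivIntegrallyClosed
    (Ring.DirectLimit.isDivIntegrallyClosed (fun i j h ↦ hf i j h π) hof fun i ↦
      isDivIntegrallyClosed_of_away (htf i) (hic i))).mem_range_of_isIntegral hnzd⟩
end

section
/- Fix a prime number p and a natural number n, and let R = ℤ_p[T]/(T^{p^n} − 1), where ℤ_p is the ring of p-adic integers. Then the integral closure of R in R[1/p] is isomorphic, as an R-algebra, to the product ∏_{i=0}^{n} ℤ_p[T]/(Φ_{p^i}(T)), where Φ_m denotes the m-th cyclotomic polynomial and the R-algebra structure on the product is induced by T ↦ (T, …, T). (Here one uses the factorization T^{p^n} − 1 = ∏_{i=0}^{n} Φ_{p^i}(T) over ℤ_p.) -/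
set_option synthInstance.maxHeartbeats 1000000
set_option maxHeartbeats 1000000
open Polynomial

/-- The ring `ℤ_p[T]/(T^{p^n} - 1)`. -/
noncomputable abbrev padicGroupRing (p n : ℕ) [Fact p.Prime] : Type :=
  Polynomial ℤ_[p] ⧸ Ideal.span {(X : Polynomial ℤ_[p]) ^ p ^ n - 1}

/-- Every fraction `s / a` that is integral over `A` lies in `A`, expressed without
denominators: a root `s` of a monic polynomial with roots scaled by `a` is divisible by `a`. -/
def IsIntegrallyDivisible {A : Type*} [CommRing A] (a : A) : Prop :=
  ∀ f : A[X], f.Monic → ∀ s : A, (f.scaleRoots a).eval s = 0 → a ∣ s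

theorem dvd_pow_natDegree_of_eval_scaleRoots_eq_zero {A : Type*} [CommRing A] {f : A[X]}
    (hf : f.Monic) {a s : A} (h : (f.scaleRoots a).eval s = 0) : a ∣ s ^ f.natDegree := by
  rw [eval_eq_sum_range, natDegree_scaleRoots, Finset.sum_range_succ,
    coeff_scaleRoots_natDegree, hf.leadingCoeff, one_mul] at h
  rw [eq_neg_of_add_eq_zero_right h, dvd_neg]
  refine Finset.dvd_sum fun i hi => ?_
  rw [coeff_scaleRoots]
  have hi : f.natDegree - i ≠ 0 := by have := Finset.mem_range.mp hi; omega
  exact ((dvd_pow_self a hi).mul_left _).mul_right _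

theorem IsIntegrallyDivisible.of_dvd_pow {A : Type*} [CommRing A] {a ϖ : A} {m : ℕ}
    (ha : a ∈ nonZeroDivisors A) (hϖ : ϖ ∈ nonZeroDivisors A)
    (hrad : ∀ (t : A) (d : ℕ), ϖ ∣ t ^ d → ϖ ∣ t) (hdvd : a ∣ ϖ ^ m) :
    IsIntegrallyDivisible a := by
  intro f hf s hs
  suffices H : ∀ j, a ∣ ϖ ^ j * s → a ∣ s from H m (hdvd.mul_right s)
  intro j
  induction j with
  | zero => intro h; simpa using h
  | succ j ih =>
    rintro ⟨t, ht⟩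
    have hroot : (f.scaleRoots (ϖ ^ (j + 1))).eval t = 0 := by
      have h1 := scaleRoots_eval_mul (f.scaleRoots (ϖ ^ (j + 1))) t a
      have h2 := scaleRoots_eval_mul (f.scaleRoots a) s (ϖ ^ (j + 1))
      rw [← scaleRoots_mul] at h1 h2
      rw [hs, mul_zero, mul_comm a, ht, h1] at h2
      exact (mul_left_mem_nonZeroDivisors_eq_zero_iff (pow_mem ha _)).mp h2
    obtain ⟨u, rfl⟩ := hrad t _ <| (dvd_pow_self ϖ j.succ_ne_zero).trans
      (dvd_pow_natDegree_of_eval_scaleRoots_eq_zero hf hroot)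
    refine ih ⟨u, ?_⟩
    refine (mul_cancel_left_mem_nonZeroDivisors hϖ).mp ?_
    linear_combination ht

theorem IsIntegrallyDivisible.pi {ι : Type*} {A : ι → Type*} [∀ i, CommRing (A i)]
    {a : ∀ i, A i} (h : ∀ i, IsIntegrallyDivisible (a i)) : IsIntegrallyDivisible a := by
  intro f hf s hs
  refine pi_dvd_iff.mpr fun i => ?_
  cases subsingleton_or_nontrivial (A i) with
  | inl _ => exact ⟨0, Subsingleton.elim _ _⟩
  | inr _ =>
    refine h i _ (hf.map (Pi.evalRingHom A i)) (s i) ?_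
    have := congrArg (Pi.evalRingHom A i) hs
    rw [map_zero, ← eval_map_apply, map_scaleRoots _ _ _ (by simp [hf.leadingCoeff])] at this
    exact this

theorem exists_integralClosure_ringEquiv {R S : Type*} [CommRing R] [CommRing S]
    (φ : R →+* S) (a : R) (hker : ∀ r, φ r = 0 → ∃ k, a ^ k * r = 0)
    (hrange : ∀ s, ∃ k r, φ r = φ a ^ k * s) (hint : φ.IsIntegral)
    (ha : φ a ∈ nonZeroDivisors S) (hdiv : ∀ k, IsIntegrallyDivisible (φ a ^ k)) :
    ∃ e : integralClosure R (Localization.Away a) ≃+* S, ∀ r, e (algebraMap R _ r) = φ r := by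
  let _ : Algebra R S := φ.toAlgebra
  have hφ : ∀ r, algebraMap R S r = φ r := fun _ => rfl
  let L := Localization.Away (φ a)
  have hinj : Function.Injective (algebraMap S L) :=
    IsLocalization.injective (M := Submonoid.powers (φ a)) L (Submonoid.powers_le.mpr ha)
  have hunit : IsUnit (algebraMap S L (φ a)) := IsLocalization.Away.algebraMap_isUnit _
  have : IsLocalization.Away a L := by
    refine IsLocalization.Away.mk a ?_ ?_ ?_
    · rwa [IsScalarTower.algebraMap_apply R S L, hφ]
    · intro s
      obtain ⟨n, t, ht⟩ := IsLocalization.Away.surj (φ a) s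
      obtain ⟨k, r, hr⟩ := hrange t
      refine ⟨n + k, r, ?_⟩
      rw [IsScalarTower.algebraMap_apply R S L, IsScalarTower.algebraMap_apply R S L, hφ, hφ, hr,
        map_mul, ← ht, map_pow]
      ring
    · intro b c h
      rw [IsScalarTower.algebraMap_apply R S L, IsScalarTower.algebraMap_apply R S L] at h
      obtain ⟨k, hk⟩ := hker (b - c) (by rw [map_sub, sub_eq_zero]; exact hinj h)
      exact ⟨k, by linear_combination hk⟩
  have : Algebra.IsIntegral R S := ⟨hint⟩
  have hclosed : ∀ x : L, IsIntegral S x → ∃ y, algebraMap S L y = x := by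
    rintro x ⟨f, hf, hfx⟩
    obtain ⟨n, t, ht⟩ := IsLocalization.Away.surj (φ a) x
    have h := scaleRoots_eval₂_eq_zero (algebraMap S L) (s := φ a ^ n) hfx
    rw [map_pow, mul_comm, ht, eval₂_at_apply] at h
    obtain ⟨u, rfl⟩ := hdiv n f hf t ((map_eq_zero_iff _ hinj).mp h)
    refine ⟨u, (hunit.pow n).mul_left_cancel ?_⟩
    rw [mul_comm _ x, ht, map_mul, map_pow]
  have : IsIntegralClosure S R L :=
    ⟨hinj, fun {x} => ⟨fun hx => hclosed x hx.tower_top,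
      by rintro ⟨y, rfl⟩; exact (Algebra.IsIntegral.isIntegral y).algebraMap⟩⟩
  let e₁ := (IsLocalization.algEquiv (Submonoid.powers a) (Localization.Away a) L).mapIntegralClosure
  let e₂ := IsIntegralClosure.equiv R (integralClosure R L) L S
  exact ⟨(e₁.trans e₂).toRingEquiv, fun r => (e₁.trans e₂).commutes r⟩

theorem mk_C_mem_nonZeroDivisors {A : Type*} [CommRing A] [IsDomain A] {f : A[X]} (hf : f.Monic)
    {c : A} (hc : c ≠ 0) :
    Ideal.Quotient.mk (Ideal.span {f}) (C c) ∈ nonZeroDivisors (A[X] ⧸ Ideal.span {f}) := by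
  rw [mem_nonZeroDivisors_iff_right]
  intro x hx
  obtain ⟨q, rfl⟩ := Ideal.Quotient.mk_surjective x
  rw [← map_mul, Ideal.Quotient.eq_zero_iff_dvd, ← modByMonic_eq_zero_iff_dvd hf, mul_comm,
    ← smul_eq_C_mul, smul_modByMonic, smul_eq_zero_iff_right hc] at hx
  rwa [Ideal.Quotient.eq_zero_iff_dvd, ← modByMonic_eq_zero_iff_dvd hf]

theorem prod_dvd_derivative_prod_mul {A ι : Type*} [CommRing A] [Fintype ι] {f : ι → A[X]}
    {q : A[X]} (h : ∀ i, f i ∣ q) : ∏ i, f i ∣ derivative (∏ i, f i) * q := by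
  classical
  rw [derivative_prod_finset, Finset.sum_mul]
  refine Finset.dvd_sum fun i _ => ?_
  rw [← Finset.prod_erase_mul _ _ (Finset.mem_univ i), mul_assoc]
  exact mul_dvd_mul_left _ ((h i).mul_left _)

theorem exists_forall_dvd_sub_derivative_prod_mul {A ι : Type*} [CommRing A] [Fintype ι]
    (f q : ι → A[X]) : ∃ r, ∀ j, f j ∣ r - derivative (∏ i, f i) * q j := by
  classical
  refine ⟨∑ i, (∏ b ∈ Finset.univ.erase i, f b) * derivative (f i) * q i, fun j => ?_⟩
  rw [derivative_prod_finset, Finset.sum_mul, ← Finset.sum_sub_distrib]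
  refine Finset.dvd_sum fun i _ => ?_
  rw [← mul_sub]
  obtain rfl | hij := eq_or_ne i j
  · simp
  · exact ((Finset.dvd_prod_of_mem f (Finset.mem_erase.mpr
      ⟨hij.symm, Finset.mem_univ j⟩)).mul_right _).mul_right _

theorem natCast_dvd_cyclotomic_prime_pow_sub (A : Type*) [CommRing A] (p k : ℕ) [Fact p.Prime] :
    (p : A[X]) ∣ cyclotomic (p ^ (k + 1)) A - (X - 1) ^ (p ^ (k + 1) - p ^ k) := by
  have h : (C (p : ℤ)) ∣ cyclotomic (p ^ (k + 1)) ℤ - (X - 1) ^ (p ^ (k + 1) - p ^ k) := by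
    rw [C_dvd_iff_dvd_coeff]
    intro i
    rw [← ZMod.intCast_zmod_eq_zero_iff_dvd, ← eq_intCast (Int.castRingHom (ZMod p)), ← coeff_map]
    have := cyclotomic_mul_prime_pow_eq (ZMod p) (p := p) (m := 1)
      (Nat.Prime.not_dvd_one Fact.out) k.succ_pos
    simp only [mul_one, cyclotomic_one, Nat.succ_eq_add_one, Nat.add_sub_cancel] at this
    simp [this]
  simpa using map_dvd (mapRingHom (Int.castRingHom A)) h

/-- A uniformizer of `A[ζ]` over `p`, `ζ` a root of `Φ_{p^k}`: `p` itself if `k = 0`, and `ζ - 1` otherwise. -/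
theorem exists_uniformizer_cyclotomic_prime_pow (A : Type*) [CommRing A] (p k : ℕ)
    [Fact p.Prime] :
    ∃ ϖ : A[X] ⧸ Ideal.span {cyclotomic (p ^ k) A},
      (∀ q : A[X], ϖ ∣ Ideal.Quotient.mk _ q ↔ (p : A) ∣ q.eval 1) ∧
        ∃ m : ℕ, (p : A[X] ⧸ Ideal.span {cyclotomic (p ^ k) A}) ∣ ϖ ^ m := by
  have hX (q : A[X]) : X - 1 ∣ q - C (q.eval 1) := by
    simpa using X_sub_C_dvd_sub_C_eval (a := (1 : A)) (p := q)
  have hC {q : A[X]} {c : A} (hc : q.eval 1 = p * c) : C (q.eval 1) = (p : A[X]) * C c := by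
    rw [hc, C_mul, C_eq_natCast]
  have hdvd (ϖ q : A[X]) : Ideal.Quotient.mk (Ideal.span {cyclotomic (p ^ k) A}) ϖ ∣
      Ideal.Quotient.mk _ q ↔ ∃ g h, q = ϖ * g + cyclotomic (p ^ k) A * h := by
    constructor
    · rintro ⟨g, hg⟩
      obtain ⟨g, rfl⟩ := Ideal.Quotient.mk_surjective g
      rw [← map_mul, Ideal.Quotient.mk_eq_mk_iff_sub_mem, Ideal.mem_span_singleton] at hg
      obtain ⟨h, hh⟩ := hg
      exact ⟨g, h, by linear_combination hh⟩
    · rintro ⟨g, h, rfl⟩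
      refine ⟨Ideal.Quotient.mk _ g, ?_⟩
      rw [← map_mul, Ideal.Quotient.mk_eq_mk_iff_sub_mem, Ideal.mem_span_singleton]
      exact ⟨h, by ring⟩
  cases k with
  | zero =>
    rw [pow_zero, cyclotomic_one] at *
    refine ⟨Ideal.Quotient.mk _ (p : A[X]), fun q => ?_, 1, by simp⟩
    rw [hdvd]
    constructor
    · rintro ⟨g, h, rfl⟩
      simp
    · rintro ⟨c, hc⟩
      obtain ⟨h, hh⟩ := hX q
      exact ⟨C c, h, by linear_combination hh + hC hc⟩
  | succ k =>
    refine ⟨Ideal.Quotient.mk _ (X - 1), fun q => ?_, p ^ (k + 1) - p ^ k, ?_⟩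
    · rw [hdvd]
      constructor
      · rintro ⟨g, h, rfl⟩
        simp [eval_one_cyclotomic_prime_pow]
      · rintro ⟨c, hc⟩
        obtain ⟨h, hh⟩ := hX q
        obtain ⟨g, hg⟩ := hX (cyclotomic (p ^ (k + 1)) A)
        rw [eval_one_cyclotomic_prime_pow, C_eq_natCast] at hg
        exact ⟨h - g * C c, C c, by linear_combination hh + hC hc - C c * hg⟩
    · obtain ⟨c, hc⟩ := natCast_dvd_cyclotomic_prime_pow_sub A p k
      rw [← map_natCast (Ideal.Quotient.mk _), ← map_pow, hdvd]
      exact ⟨-c, 1, by linear_combination -hc⟩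

theorem natCast_mem_nonZeroDivisors_cyclotomic (p m : ℕ) [Fact p.Prime] :
    (p : ℤ_[p][X] ⧸ Ideal.span {cyclotomic m ℤ_[p]}) ∈ nonZeroDivisors _ := by
  have hp : (p : ℤ_[p]) ≠ 0 := Nat.cast_ne_zero.mpr (Fact.out : p.Prime).ne_zero
  simpa using mk_C_mem_nonZeroDivisors (cyclotomic.monic m ℤ_[p]) hp

theorem isIntegrallyDivisible_pow_cyclotomic_prime_pow (p i k : ℕ) [Fact p.Prime] :
    IsIntegrallyDivisible ((p : ℤ_[p][X] ⧸ Ideal.span {cyclotomic (p ^ i) ℤ_[p]}) ^ k) := by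
  obtain ⟨ϖ, hϖ, m, hm⟩ := exists_uniformizer_cyclotomic_prime_pow ℤ_[p] p i
  have hp := natCast_mem_nonZeroDivisors_cyclotomic p (p ^ i)
  have hdvd : ϖ ∣ (p : ℤ_[p][X] ⧸ Ideal.span {cyclotomic (p ^ i) ℤ_[p]}) := by
    simpa using (hϖ (p : ℤ_[p][X])).mpr (by simp)
  refine .of_dvd_pow (ϖ := ϖ) (m := m * k) (pow_mem hp k) ?_ ?_ ?_
  · obtain ⟨u, hu⟩ := hdvd
    rw [hu] at hp
    exact (mul_mem_nonZeroDivisors.mp hp).1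
  · intro t d
    obtain ⟨q, rfl⟩ := Ideal.Quotient.mk_surjective t
    rw [← map_pow, hϖ, hϖ, eval_pow]
    exact PadicInt.prime_p.dvd_of_dvd_pow
  · rw [pow_mul]
    exact pow_dvd_pow_of_dvd hm k

theorem prod_cyclotomic_prime_pow_eq (A : Type*) [CommRing A] (p n : ℕ) [hp : Fact p.Prime] :
    ∏ i : Fin (n + 1), cyclotomic (p ^ (i : ℕ)) A = X ^ p ^ n - 1 := by
  rw [Fin.prod_univ_eq_prod_range (fun i => cyclotomic (p ^ i) A),
    ← prod_cyclotomic_eq_X_pow_sub_one (pow_pos hp.out.pos n) A,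
    Nat.prod_divisors_prime_pow hp.out]

theorem X_mul_derivative_X_pow_sub_one {A : Type*} [CommRing A] {m : ℕ} (hm : 0 < m) :
    X * derivative (X ^ m - 1 : A[X]) = (m : A[X]) * (X ^ m - 1) + (m : A[X]) := by
  obtain ⟨m, rfl⟩ := Nat.exists_eq_add_of_le' hm
  simp only [derivative_sub, derivative_X_pow, derivative_one, Nat.add_sub_cancel, C_eq_natCast]
  ring

/-- For a prime `p` and `n : ℕ`, let `R = ℤ_p[T]/(T^{p^n} − 1)`.  The
integral closure of `R` in `R[1/p]` is isomorphic, as an `R`-algebra, to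
`∏_{i=0}^{n} ℤ_p[T]/(Φ_{p^i}(T))`, the `R`-algebra structure on the product being induced
by `T ↦ (T, …, T)` (i.e. the isomorphism carries the image of any `q ∈ ℤ_p[T]` in `R`
to the tuple of its classes modulo the cyclotomic polynomials `Φ_{p^i}`). -/
theorem stmt15 (p : ℕ) [Fact p.Prime] (n : ℕ) :
    ∃ e : integralClosure (padicGroupRing p n)
            (Localization.Away ((p : padicGroupRing p n))) ≃+*
          (∀ i : Fin (n + 1),
            Polynomial ℤ_[p] ⧸ Ideal.span {cyclotomic (p ^ (i : ℕ)) ℤ_[p]}),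
      ∀ q : Polynomial ℤ_[p],
        e (algebraMap (padicGroupRing p n)
            (integralClosure (padicGroupRing p n)
              (Localization.Away ((p : padicGroupRing p n))))
            (Ideal.Quotient.mk (Ideal.span {(X : Polynomial ℤ_[p]) ^ p ^ n - 1}) q)) =
          fun i : Fin (n + 1) => Ideal.Quotient.mk (Ideal.span {cyclotomic (p ^ (i : ℕ)) ℤ_[p]}) q := by
  set F : ℤ_[p][X] := X ^ p ^ n - 1 with hF
  have hprod : ∏ i : Fin (n + 1), cyclotomic (p ^ (i : ℕ)) ℤ_[p] = F :=
    prod_cyclotomic_prime_pow_eq ℤ_[p] p n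
  have hder : X * derivative F = (p : ℤ_[p][X]) ^ n * F + (p : ℤ_[p][X]) ^ n := by
    rw [hF, X_mul_derivative_X_pow_sub_one (pow_pos (Fact.out : p.Prime).pos n), Nat.cast_pow]
  have hdvd (i : Fin (n + 1)) : cyclotomic (p ^ (i : ℕ)) ℤ_[p] ∣ F :=
    hprod ▸ Finset.dvd_prod_of_mem _ (Finset.mem_univ i)
  let ψ : ℤ_[p][X] →+* ∀ i : Fin (n + 1), ℤ_[p][X] ⧸ Ideal.span {cyclotomic (p ^ (i : ℕ)) ℤ_[p]} :=
    RingHom.pi fun i => Ideal.Quotient.mk _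
  let φ : padicGroupRing p n →+*
      ∀ i : Fin (n + 1), ℤ_[p][X] ⧸ Ideal.span {cyclotomic (p ^ (i : ℕ)) ℤ_[p]} :=
    Ideal.Quotient.lift _ ψ fun q hq => funext fun i =>
      Ideal.Quotient.eq_zero_iff_dvd _ _ |>.mpr <|
        (hdvd i).trans (Ideal.mem_span_singleton.mp hq)
  have hφ (q : ℤ_[p][X]) (i) : φ (Ideal.Quotient.mk _ q) i = Ideal.Quotient.mk _ q := rfl
  refine (exists_integralClosure_ringEquiv φ (p : padicGroupRing p n)
    ?_ ?_ ?_ ?_ ?_).imp fun e he q => he _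
  · intro r hr
    obtain ⟨q, rfl⟩ := Ideal.Quotient.mk_surjective r
    obtain ⟨g, hg⟩ := prod_dvd_derivative_prod_mul
      (f := fun i : Fin (n + 1) => cyclotomic (p ^ (i : ℕ)) ℤ_[p]) (q := q)
      fun i => (Ideal.Quotient.eq_zero_iff_dvd _ _).mp (congrFun hr i)
    rw [hprod] at hg
    refine ⟨n, ?_⟩
    rw [← map_natCast (Ideal.Quotient.mk _), ← map_pow, ← map_mul, Ideal.Quotient.eq_zero_iff_dvd]
    exact ⟨X * g - (p : ℤ_[p][X]) ^ n * q, by linear_combination X * hg - q * hder⟩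
  · intro s
    choose q hq using fun i => Ideal.Quotient.mk_surjective (s i)
    obtain ⟨r, hr⟩ := exists_forall_dvd_sub_derivative_prod_mul
      (fun i : Fin (n + 1) => cyclotomic (p ^ (i : ℕ)) ℤ_[p]) q
    refine ⟨n, Ideal.Quotient.mk _ (X * r), funext fun i => ?_⟩
    rw [hφ, map_natCast, Pi.mul_apply, Pi.pow_apply, Pi.natCast_apply, ← hq,
      ← map_natCast (Ideal.Quotient.mk _), ← map_pow, ← map_mul,
      Ideal.Quotient.mk_eq_mk_iff_sub_mem, Ideal.mem_span_singleton]
    have h := ((hr i).mul_left X).add ((hdvd i).mul_right ((p : ℤ_[p][X]) ^ n * q i))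
    rw [hprod] at h
    convert h using 1
    linear_combination q i * hder
  · have (i : Fin (n + 1)) :
        Module.Finite ℤ_[p] (ℤ_[p][X] ⧸ Ideal.span {cyclotomic (p ^ (i : ℕ)) ℤ_[p]}) :=
      (cyclotomic.monic _ _).finite_quotient
    have hint : (ψ.comp C).IsIntegral :=
      (Algebra.IsIntegral.of_finite ℤ_[p]
        (∀ i : Fin (n + 1), ℤ_[p][X] ⧸ Ideal.span {cyclotomic (p ^ (i : ℕ)) ℤ_[p]})).isIntegral
    exact RingHom.IsIntegral.tower_top ((Ideal.Quotient.mk _).comp C) φ hint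
  · rw [map_natCast, mem_nonZeroDivisors_iff_right]
    exact fun x hx => funext fun i => (mem_nonZeroDivisors_iff_right.mp
      (natCast_mem_nonZeroDivisors_cyclotomic p (p ^ (i : ℕ)))) _ (congrFun hx i)
  · intro k
    rw [map_natCast]
    exact .pi fun i => isIntegrallyDivisible_pow_cyclotomic_prime_pow p i k
end
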